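/- arXiv:1205.4089 — 2 statements merged into one kernel-verified Lean document; each statement's English description precedes it below -/
import Mathlib

section
/- Explicit variance of the optimal hedging error: under Assumptions A and B (with F_0 trivial), the minimal quadratic hedging error J_0 = E[(H − V_0* − Σ_{k=1}^N φ*_k ΔS_k)²] for H = f(S_N) is J_0 = ∫_ℂ ∫_ℂ J_0(y,z) Π(dy) Π(dz), where for y, z ∈ supp Π, J_0(y,z) = s_0^{y+z} Σ_{k=1}^N b(y,z;k) h(z,k) h(y,k) · ∏_{ℓ=2}^k m(y+z, ℓ−1) · ∏_{j=k+1}^N a(j), and J_0(y,z) = 0 otherwise; here a(j) = (m(2,j) − m(1,j)²)/(m(2,j) − 2m(1,j) + 1), ρ(y,z;k) = m(y+z,k) − m(y,k)m(z,k), and b(y,z;k) = (ρ(y,z;k)ρ(1,1;k) − ρ(y,1;k)ρ(z,1;k))/ρ(1,1;k). -/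
open MeasureTheory ProbabilityTheory

theorem integral_mul_integral_swap {Ω : Type*} {m0 : MeasurableSpace Ω} {P : Measure Ω}
    [IsProbabilityMeasure P] {μ : Measure ℂ} [IsFiniteMeasure μ] {w : ℂ → ℂ} (hw : Integrable w μ)
    {K : ℂ → Ω → ℂ} (hK : Measurable (Function.uncurry K)) {B : Ω → ℝ} {Y : Ω → ℂ}
    (hY : AEStronglyMeasurable Y P) (hBY : Integrable (fun ω => B ω * ‖Y ω‖) P)
    (hbound : ∀ᵐ v ∂μ, ∀ ω, ‖K v ω‖ ≤ B ω) :
    Integrable (fun v => (∫ ω, K v ω * Y ω ∂P) * w v) μ ∧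
      ∫ ω, (∫ v, K v ω * w v ∂μ) * Y ω ∂P = ∫ v, (∫ ω, K v ω * Y ω ∂P) * w v ∂μ := by
  have hint : Integrable (fun p : ℂ × Ω => K p.1 p.2 * Y p.2 * w p.1) (μ.prod P) := by
    refine (hw.norm.mul_prod hBY).mono' ?_ ?_
    · exact (hK.aestronglyMeasurable.mul hY.comp_snd).mul hw.1.comp_fst
    · have := Measure.quasiMeasurePreserving_fst (μ := μ) (ν := P) |>.ae hbound
      filter_upwards [this] with p hp
      rw [norm_mul, norm_mul, mul_comm]
      gcongr
      exact hp p.2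
  refine ⟨?_, ?_⟩
  · simpa only [integral_mul_const] using hint.integral_prod_left
  · calc ∫ ω, (∫ v, K v ω * w v ∂μ) * Y ω ∂P
        = ∫ ω, ∫ v, K v ω * Y ω * w v ∂μ ∂P := by
          congr with ω
          rw [← integral_mul_const]
          congr with v
          ring
      _ = ∫ v, ∫ ω, K v ω * Y ω * w v ∂P ∂μ := (integral_integral_swap hint).symm
      _ = _ := by simp only [integral_mul_const]

/-- The regression coefficient of `exp (v x)` on `exp x`. -/
noncomputable def hedgeRatio {Ω : Type*} {m0 : MeasurableSpace Ω} (P : Measure Ω) (x : Ω → ℝ)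
    (v : ℂ) : ℂ :=
  (complexMGF x P (v + 1) - complexMGF x P 1 * complexMGF x P v) /
    (complexMGF x P 2 - complexMGF x P 1 ^ 2)

/-- The residual of the regression of `exp (v x)` on `exp x`, as a function of the value of `x`. -/
noncomputable def hedgeResidual {Ω : Type*} {m0 : MeasurableSpace Ω} (P : Measure Ω) (x : Ω → ℝ)
    (v : ℂ) (r : ℝ) : ℂ :=
  Complex.exp (v * r) - complexMGF x P v - hedgeRatio P x v * (Complex.exp r - complexMGF x P 1)

section Strip

variable {Ω : Type*} {m0 : MeasurableSpace Ω} {P : Measure Ω}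
  {x : Ω → ℝ} {c d : ℝ}

theorem norm_exp_mul_le_of_re_mem_Icc {v : ℂ} (hv : v.re ∈ Set.Icc c d) (r : ℝ) :
    ‖Complex.exp (v * r)‖ ≤ Real.exp (c * r) + Real.exp (d * r) := by
  have hre : (v * (r : ℂ)).re = v.re * r := by simp
  rw [Complex.norm_exp, hre]
  rcases le_total 0 r with hr | hr
  · have : Real.exp (v.re * r) ≤ Real.exp (d * r) :=
      Real.exp_le_exp.2 (mul_le_mul_of_nonneg_right hv.2 hr)
    linarith [Real.exp_pos (c * r)]
  · have : Real.exp (v.re * r) ≤ Real.exp (c * r) :=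
      Real.exp_le_exp.2 (mul_le_mul_of_nonpos_right hv.1 hr)
    linarith [Real.exp_pos (d * r)]

theorem memLp_exp_mul (hx : Measurable x)
    (hc : MemLp (fun ω => Real.exp (c * x ω)) 2 P) (hd : MemLp (fun ω => Real.exp (d * x ω)) 2 P)
    {v : ℂ} (hv : v.re ∈ Set.Icc c d) : MemLp (fun ω => Complex.exp (v * x ω)) 2 P := by
  refine (hc.add hd).mono' (by fun_prop) (Filter.Eventually.of_forall fun ω => ?_)
  exact norm_exp_mul_le_of_re_mem_Icc hv _

theorem memLp_cexp (hx : Measurable x) (h1 : MemLp (fun ω => Real.exp (x ω)) 2 P) :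
    MemLp (fun ω => Complex.exp (x ω)) 2 P := by
  refine h1.mono' (by fun_prop) (Filter.Eventually.of_forall fun ω => ?_)
  simp [Complex.norm_exp]

variable [IsProbabilityMeasure P]

theorem measurable_complexMGF (hx : Measurable x) : Measurable (complexMGF x P) := by
  have : StronglyMeasurable (fun p : ℂ × Ω => Complex.exp (p.1 * x p.2)) :=
    Measurable.stronglyMeasurable (by fun_prop)
  exact this.integral_prod_right.measurable

theorem measurable_hedgeRatio (hx : Measurable x) : Measurable (hedgeRatio P x) := by
  have := measurable_complexMGF (P := P) hx
  unfold hedgeRatio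
  fun_prop

theorem measurable_residual (hx : Measurable x) :
    Measurable (fun p : ℂ × ℝ => hedgeResidual P x p.1 p.2) := by
  have := measurable_complexMGF (P := P) hx
  have := measurable_hedgeRatio (P := P) hx
  unfold hedgeResidual
  fun_prop

theorem exists_norm_le_of_re_mem_Icc
    (hc : MemLp (fun ω => Real.exp (c * x ω)) 2 P) (hd : MemLp (fun ω => Real.exp (d * x ω)) 2 P)
    (h1 : MemLp (fun ω => Real.exp (x ω)) 2 P) :
    ∃ C : ℝ, ∀ v : ℂ, v.re ∈ Set.Icc c d → ‖complexMGF x P v‖ ≤ C ∧ ‖hedgeRatio P x v‖ ≤ C := by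
  set A := ∫ ω, (Real.exp (c * x ω) + Real.exp (d * x ω)) ∂P
  set B := ∫ ω, (Real.exp (c * x ω) + Real.exp (d * x ω)) * Real.exp (x ω) ∂P
  have hA : ∀ v : ℂ, v.re ∈ Set.Icc c d → ‖complexMGF x P v‖ ≤ A := fun v hv =>
    norm_integral_le_of_norm_le ((hc.add hd).integrable one_le_two)
      (Filter.Eventually.of_forall fun ω => norm_exp_mul_le_of_re_mem_Icc hv _)
  have hB : ∀ v : ℂ, v.re ∈ Set.Icc c d → ‖complexMGF x P (v + 1)‖ ≤ B := fun v hv => by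
    refine norm_integral_le_of_norm_le ((hc.add hd).integrable_mul h1)
      (Filter.Eventually.of_forall fun ω => ?_)
    rw [add_mul, Complex.exp_add, norm_mul]
    refine mul_le_mul (norm_exp_mul_le_of_re_mem_Icc hv _) ?_ (norm_nonneg _) (by positivity)
    simp [Complex.norm_exp]
  refine ⟨max A ((B + ‖complexMGF x P 1‖ * A) / ‖complexMGF x P 2 - complexMGF x P 1 ^ 2‖),
    fun v hv => ⟨(hA v hv).trans (le_max_left _ _), le_max_of_le_right ?_⟩⟩
  rw [hedgeRatio, norm_div]
  gcongr
  refine (norm_sub_le _ _).trans ?_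
  rw [norm_mul]
  gcongr
  · exact hB v hv
  · exact hA v hv

theorem exists_residual_le
    (hc : MemLp (fun ω => Real.exp (c * x ω)) 2 P) (hd : MemLp (fun ω => Real.exp (d * x ω)) 2 P)
    (h1 : MemLp (fun ω => Real.exp (x ω)) 2 P) :
    ∃ β : ℝ → ℝ, Measurable β ∧ MemLp (fun ω => β (x ω)) 2 P ∧
      ∀ v : ℂ, v.re ∈ Set.Icc c d → ∀ r, ‖hedgeResidual P x v r‖ ≤ β r := by
  obtain ⟨C, hC⟩ := exists_norm_le_of_re_mem_Icc hc hd h1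
  refine ⟨fun r => Real.exp (c * r) + Real.exp (d * r) + C +
    C * (Real.exp r + ‖complexMGF x P 1‖), by fun_prop, ?_, fun v hv r => ?_⟩
  · exact ((hc.add hd).add (memLp_const C)).add ((h1.add (memLp_const _)).const_mul C)
  · have h0 := hC v hv
    unfold hedgeResidual
    refine (norm_sub_le _ _).trans (add_le_add ((norm_sub_le _ _).trans (add_le_add
      (norm_exp_mul_le_of_re_mem_Icc hv r) h0.1)) ?_)
    rw [norm_mul]
    refine mul_le_mul h0.2 ((norm_sub_le _ _).trans ?_) (norm_nonneg _)
      ((norm_nonneg _).trans h0.2)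
    simp [Complex.norm_exp]

theorem memLp_residual (hx : Measurable x)
    (hc : MemLp (fun ω => Real.exp (c * x ω)) 2 P) (hd : MemLp (fun ω => Real.exp (d * x ω)) 2 P)
    (h1 : MemLp (fun ω => Real.exp (x ω)) 2 P) {v : ℂ} (hv : v.re ∈ Set.Icc c d) :
    MemLp (fun ω => hedgeResidual P x v (x ω)) 2 P := by
  obtain ⟨β, -, hβ, hb⟩ := exists_residual_le hc hd h1
  refine hβ.mono' ?_ (Filter.Eventually.of_forall fun ω => hb v hv _)
  exact ((measurable_residual hx).comp (measurable_const.prodMk hx)).aestronglyMeasurable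

theorem integral_residual_mul (hx : Measurable x)
    (hc : MemLp (fun ω => Real.exp (c * x ω)) 2 P) (hd : MemLp (fun ω => Real.exp (d * x ω)) 2 P)
    (h1 : MemLp (fun ω => Real.exp (x ω)) 2 P) {v : ℂ} (hv : v.re ∈ Set.Icc c d)
    {q : Ω → ℂ} (hq : MemLp q 2 P) :
    ∫ ω, hedgeResidual P x v (x ω) * q ω ∂P =
      (∫ ω, Complex.exp (v * x ω) * q ω ∂P) - complexMGF x P v * (∫ ω, q ω ∂P) -
        hedgeRatio P x v * ((∫ ω, Complex.exp (x ω) * q ω ∂P) - complexMGF x P 1 * ∫ ω, q ω ∂P) := by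
  have i1 : Integrable (fun ω => Complex.exp (v * x ω) * q ω) P :=
    (memLp_exp_mul hx hc hd hv).integrable_mul hq
  have i2 : Integrable (fun ω => Complex.exp (x ω) * q ω) P := (memLp_cexp hx h1).integrable_mul hq
  have i3 : Integrable q P := hq.integrable one_le_two
  simp only [hedgeResidual, sub_mul, mul_assoc]
  have i4 : Integrable (fun ω => Complex.exp (v * x ω) * q ω - complexMGF x P v * q ω) P :=
    i1.sub (i3.const_mul _)
  have i5 : Integrable (fun ω => Complex.exp (x ω) * q ω - complexMGF x P 1 * q ω) P :=
    i2.sub (i3.const_mul _)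
  rw [integral_sub i4 (i5.const_mul _), integral_sub i1 (i3.const_mul _), integral_const_mul,
    integral_const_mul, integral_sub i2 (i3.const_mul _), integral_const_mul]

theorem integral_residual (hx : Measurable x)
    (hc : MemLp (fun ω => Real.exp (c * x ω)) 2 P) (hd : MemLp (fun ω => Real.exp (d * x ω)) 2 P)
    (h1 : MemLp (fun ω => Real.exp (x ω)) 2 P) {v : ℂ} (hv : v.re ∈ Set.Icc c d) :
    ∫ ω, hedgeResidual P x v (x ω) ∂P = 0 := by
  have := integral_residual_mul hx hc hd h1 hv (memLp_const 1)
  simpa [complexMGF] using this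

theorem integral_residual_mul_exp (hx : Measurable x)
    (hc : MemLp (fun ω => Real.exp (c * x ω)) 2 P) (hd : MemLp (fun ω => Real.exp (d * x ω)) 2 P)
    (h1 : MemLp (fun ω => Real.exp (x ω)) 2 P)
    (hvar : complexMGF x P 2 - complexMGF x P 1 ^ 2 ≠ 0) {v : ℂ} (hv : v.re ∈ Set.Icc c d) :
    ∫ ω, hedgeResidual P x v (x ω) * Complex.exp (x ω) ∂P = 0 := by
  rw [integral_residual_mul hx hc hd h1 hv (memLp_cexp hx h1)]
  have e1 : ∫ ω, Complex.exp (v * x ω) * Complex.exp (x ω) ∂P = complexMGF x P (v + 1) := by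
    simp [complexMGF, add_mul, Complex.exp_add]
  have e2 : ∫ ω, Complex.exp (x ω) * Complex.exp (x ω) ∂P = complexMGF x P 2 := by
    simp [complexMGF, two_mul, Complex.exp_add]
  have e3 : ∫ ω, Complex.exp (x ω) ∂P = complexMGF x P 1 := by simp [complexMGF]
  rw [e1, e2, e3, hedgeRatio]
  field_simp
  ring

theorem integral_residual_mul_residual (hx : Measurable x)
    (hc : MemLp (fun ω => Real.exp (c * x ω)) 2 P) (hd : MemLp (fun ω => Real.exp (d * x ω)) 2 P)
    (h1 : MemLp (fun ω => Real.exp (x ω)) 2 P)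
    (hvar : complexMGF x P 2 - complexMGF x P 1 ^ 2 ≠ 0) {y z : ℂ} (hy : y.re ∈ Set.Icc c d)
    (hz : z.re ∈ Set.Icc c d) :
    ∫ ω, hedgeResidual P x y (x ω) * hedgeResidual P x z (x ω) ∂P =
      complexMGF x P (y + z) - complexMGF x P y * complexMGF x P z -
        hedgeRatio P x y * (complexMGF x P (z + 1) - complexMGF x P 1 * complexMGF x P z) := by
  rw [integral_residual_mul hx hc hd h1 hy (memLp_residual hx hc hd h1 hz)]
  have e1 : ∫ ω, Complex.exp (y * x ω) * hedgeResidual P x z (x ω) ∂P =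
      complexMGF x P (y + z) - complexMGF x P y * complexMGF x P z -
        hedgeRatio P x y * (complexMGF x P (z + 1) - complexMGF x P 1 * complexMGF x P z) := by
    simp_rw [mul_comm (Complex.exp _)]
    rw [integral_residual_mul hx hc hd h1 hz (memLp_exp_mul hx hc hd hy)]
    have e1 : ∫ ω, Complex.exp (z * x ω) * Complex.exp (y * x ω) ∂P = complexMGF x P (y + z) := by
      simp only [complexMGF, add_mul, Complex.exp_add, mul_comm (Complex.exp (y * _))]
    have e2 : ∫ ω, Complex.exp (x ω) * Complex.exp (y * x ω) ∂P = complexMGF x P (y + 1) := by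
      simp only [complexMGF, add_mul, one_mul, Complex.exp_add, mul_comm (Complex.exp (y * _))]
    have e3 : ∫ ω, Complex.exp (y * x ω) ∂P = complexMGF x P y := by simp [complexMGF]
    rw [e1, e2, e3, hedgeRatio, hedgeRatio]
    field_simp
  have e2 : ∫ ω, Complex.exp (x ω) * hedgeResidual P x z (x ω) ∂P = 0 := by
    simp_rw [mul_comm (Complex.exp _)]
    exact integral_residual_mul_exp hx hc hd h1 hvar hz
  rw [e1, e2, integral_residual hx hc hd h1 hz]
  ring

/-- If `x` is not a.s. constant, then `exp x` has positive variance. -/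
theorem mgf_one_sq_lt_mgf_two (h1 : MemLp (fun ω => Real.exp (x ω)) 2 P)
    (hconst : ¬ ∃ k : ℝ, x =ᵐ[P] fun _ => k) : mgf x P 1 ^ 2 < mgf x P 2 := by
  have hv : Var[fun ω => Real.exp (x ω); P] = mgf x P 2 - mgf x P 1 ^ 2 := by
    rw [variance_eq_sub h1]
    congr 2
    · simp [two_mul, Real.exp_add, pow_two]
    · simp [mgf]
  have hne : Var[fun ω => Real.exp (x ω); P] ≠ 0 := fun h0 => hconst
    ⟨Real.log (∫ ω, Real.exp (x ω) ∂P), by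
      filter_upwards [ae_eq_integral_of_variance_eq_zero h1 h0] with ω hω
      rw [← hω, Real.log_exp]⟩
  have hpos := lt_of_le_of_ne (variance_nonneg (fun ω => Real.exp (x ω)) P) hne.symm
  linarith

end Strip

theorem ProbabilityTheory.IndepFun.memLp_two_mul {Ω : Type*} {m0 : MeasurableSpace Ω}
    {P : Measure Ω} {f g : Ω → ℝ} (hfg : IndepFun f g P) (hf : MemLp f 2 P) (hg : MemLp g 2 P) :
    MemLp (fun ω => f ω * g ω) 2 P := by
  refine (memLp_two_iff_integrable_sq (hf.1.mul hg.1)).2 ?_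
  have := (hfg.comp (measurable_id.pow_const 2) (measurable_id.pow_const 2)).integrable_mul
    hf.integrable_sq hg.integrable_sq
  refine this.congr (Filter.Eventually.of_forall fun ω => ?_)
  simp [mul_pow]

theorem indepFun_of_indep_comap {Ω β γ : Type*} {𝓖 m0 : MeasurableSpace Ω} {P : Measure Ω}
    [MeasurableSpace β] [MeasurableSpace γ] {x : Ω → ℝ}
    (hind : Indep 𝓖 (MeasurableSpace.comap x inferInstance) P)
    {f : Ω → β} (hf : Measurable[𝓖] f) {q : ℝ → γ} (hq : Measurable q) :
    IndepFun f (fun ω => q (x ω)) P := by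
  rw [IndepFun_iff_Indep]
  refine indep_of_indep_of_le_left (indep_of_indep_of_le_right hind ?_) hf.comap_le
  exact (hq.comp (comap_measurable x)).comap_le

/-- One period of a hedging problem: the log-price `T` is known at the beginning of the period, `x`
is the independent log-return over the period, and the value at the end of the period is
`∫ h(v) exp (v (T + x)) w(v) μ(dv)`, where `μ` is carried by the strip `c ≤ re v ≤ d`. -/
structure HedgeStep {Ω : Type*} (𝓖 : MeasurableSpace Ω) {m0 : MeasurableSpace Ω} (P : Measure Ω)
    (μ : Measure ℂ) (w : ℂ → ℂ) (c d : ℝ) (x T : Ω → ℝ) (h : ℂ → ℂ) : Prop where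
  weight : Integrable w μ
  strip : ∀ᵐ v ∂μ, v.re ∈ Set.Icc c d
  meas_x : Measurable x
  memLp_left : MemLp (fun ω => Real.exp (c * x ω)) 2 P
  memLp_right : MemLp (fun ω => Real.exp (d * x ω)) 2 P
  memLp_one : MemLp (fun ω => Real.exp (x ω)) 2 P
  var_ne : complexMGF x P 2 - complexMGF x P 1 ^ 2 ≠ 0
  sub_le : 𝓖 ≤ m0
  meas_T : Measurable[𝓖] T
  indep : Indep 𝓖 (MeasurableSpace.comap x inferInstance) P
  memLp_left_T : MemLp (fun ω => Real.exp (c * T ω)) 2 P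
  memLp_right_T : MemLp (fun ω => Real.exp (d * T ω)) 2 P
  meas_h : Measurable h
  bdd_h : ∃ C, ∀ v : ℂ, v.re ∈ Set.Icc c d → ‖h v‖ ≤ C

/-- The unhedgeable part of `h(v) exp (v (T + x))`. -/
noncomputable def stepKernel {Ω : Type*} {m0 : MeasurableSpace Ω} (P : Measure Ω) (x T : Ω → ℝ)
    (h : ℂ → ℂ) (v : ℂ) (ω : Ω) : ℂ :=
  h v * Complex.exp (v * T ω) * hedgeResidual P x v (x ω)

/-- The unhedgeable part of `∫ h(v) exp (v (T + x)) w(v) μ(dv)`. -/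
noncomputable def stepGain {Ω : Type*} {m0 : MeasurableSpace Ω} (P : Measure Ω) (μ : Measure ℂ)
    (w : ℂ → ℂ) (x T : Ω → ℝ) (h : ℂ → ℂ) (ω : Ω) : ℂ :=
  ∫ v, stepKernel P x T h v ω * w v ∂μ

namespace HedgeStep

variable {Ω : Type*} {𝓖 m0 : MeasurableSpace Ω} {P : Measure Ω} [IsProbabilityMeasure P]
  {μ : Measure ℂ} {w : ℂ → ℂ} {c d : ℝ} {x T : Ω → ℝ} {h : ℂ → ℂ}

theorem measurable_kernel (hs : HedgeStep 𝓖 P μ w c d x T h) :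
    Measurable (Function.uncurry (stepKernel P x T h)) := by
  have hT : Measurable T := hs.meas_T.mono hs.sub_le le_rfl
  have hx := hs.meas_x
  have hh := hs.meas_h
  have hr : Measurable (fun p : ℂ × Ω => hedgeResidual P x p.1 (x p.2)) :=
    (measurable_residual hx).comp (measurable_fst.prodMk (hx.comp measurable_snd))
  have he : Measurable (fun p : ℂ × Ω => h p.1 * Complex.exp (p.1 * T p.2)) := by fun_prop
  exact he.mul hr

theorem exists_kernel_le (hs : HedgeStep 𝓖 P μ w c d x T h) :
    ∃ B : Ω → ℝ, MemLp B 2 P ∧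
      ∀ v : ℂ, v.re ∈ Set.Icc c d → ∀ ω, ‖stepKernel P x T h v ω‖ ≤ B ω := by
  obtain ⟨β, hβm, hβ, hβb⟩ := exists_residual_le hs.memLp_left hs.memLp_right hs.memLp_one
  obtain ⟨C, hC⟩ := hs.bdd_h
  have hT := hs.meas_T
  refine ⟨fun ω => C * (Real.exp (c * T ω) + Real.exp (d * T ω)) * β (x ω), ?_, fun v hv ω => ?_⟩
  · refine (indepFun_of_indep_comap hs.indep ?_ hβm).memLp_two_mul
      ((hs.memLp_left_T.add hs.memLp_right_T).const_mul C) hβ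
    exact (((Real.measurable_exp.comp (hT.const_mul c)).add
      (Real.measurable_exp.comp (hT.const_mul d))).const_mul C)
  · have hC0 := (norm_nonneg _).trans (hC v hv)
    rw [stepKernel, norm_mul, norm_mul]
    refine mul_le_mul (mul_le_mul (hC v hv) (norm_exp_mul_le_of_re_mem_Icc hv _) (norm_nonneg _)
      hC0) (hβb v hv _) (norm_nonneg _) (by positivity)

theorem memLp_kernel (hs : HedgeStep 𝓖 P μ w c d x T h) {v : ℂ} (hv : v.re ∈ Set.Icc c d) :
    MemLp (stepKernel P x T h v) 2 P := by
  obtain ⟨B, hB, hb⟩ := hs.exists_kernel_le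
  exact hB.mono' (hs.measurable_kernel.comp measurable_prodMk_left).aestronglyMeasurable
    (Filter.Eventually.of_forall (hb v hv))

theorem integral_residual_mul_affine (hs : HedgeStep 𝓖 P μ w c d x T h) (κ : ℂ) {v : ℂ}
    (hv : v.re ∈ Set.Icc c d) :
    ∫ ω, hedgeResidual P x v (x ω) * (1 - κ * (Complex.exp (x ω) - 1)) ∂P = 0 := by
  have hr := memLp_residual hs.meas_x hs.memLp_left hs.memLp_right hs.memLp_one hv
  have i1 : Integrable (fun ω => hedgeResidual P x v (x ω)) P := hr.integrable one_le_two
  have i2 : Integrable (fun ω => hedgeResidual P x v (x ω) * Complex.exp (x ω)) P :=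
    hr.integrable_mul (memLp_cexp hs.meas_x hs.memLp_one)
  have e : ∀ ω, hedgeResidual P x v (x ω) * (1 - κ * (Complex.exp (x ω) - 1)) =
      (1 + κ) * hedgeResidual P x v (x ω) -
        κ * (hedgeResidual P x v (x ω) * Complex.exp (x ω)) := fun ω => by ring
  simp_rw [e]
  rw [integral_sub (i1.const_mul _) (i2.const_mul _), integral_const_mul, integral_const_mul,
    integral_residual hs.meas_x hs.memLp_left hs.memLp_right hs.memLp_one hv,
    integral_residual_mul_exp hs.meas_x hs.memLp_left hs.memLp_right hs.memLp_one hs.var_ne hv]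
  simp

theorem integral_kernel_mul_kernel (hs : HedgeStep 𝓖 P μ w c d x T h) (y z : ℂ) :
    ∫ ω, stepKernel P x T h y ω * stepKernel P x T h z ω ∂P =
      h y * h z * complexMGF T P (y + z) *
        ∫ ω, hedgeResidual P x y (x ω) * hedgeResidual P x z (x ω) ∂P := by
  have hT := hs.meas_T
  have hf : Measurable[𝓖] (fun ω => Complex.exp ((y + z) * T ω)) :=
    Complex.measurable_exp.comp ((Complex.measurable_ofReal.comp hT).const_mul (y + z))
  have hq : Measurable (fun r : ℝ => hedgeResidual P x y r * hedgeResidual P x z r) :=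
    ((measurable_residual hs.meas_x).comp measurable_prodMk_left).mul
      ((measurable_residual hs.meas_x).comp measurable_prodMk_left)
  have hprod := (indepFun_of_indep_comap hs.indep hf hq).integral_fun_mul_eq_mul_integral
    (hf.mono hs.sub_le le_rfl).aestronglyMeasurable (hq.comp hs.meas_x).aestronglyMeasurable
  rw [complexMGF, mul_assoc, ← hprod, ← integral_const_mul]
  refine integral_congr_ae (Filter.Eventually.of_forall fun ω => ?_)
  simp only [stepKernel, add_mul, Complex.exp_add]
  ring

variable [IsFiniteMeasure μ]

theorem memLp_gain (hs : HedgeStep 𝓖 P μ w c d x T h) :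
    MemLp (stepGain P μ w x T h) 2 P := by
  obtain ⟨B, hB, hb⟩ := hs.exists_kernel_le
  refine (hB.mul_const (∫ v, ‖w v‖ ∂μ)).mono' ?_ (Filter.Eventually.of_forall fun ω => ?_)
  · have : AEStronglyMeasurable (fun p : Ω × ℂ => stepKernel P x T h p.2 p.1 * w p.2)
        (P.prod μ) :=
      (hs.measurable_kernel.comp measurable_swap).aestronglyMeasurable.mul hs.weight.1.comp_snd
    exact this.integral_prod_right'
  · rw [← integral_const_mul]
    refine norm_integral_le_of_norm_le (hs.weight.norm.const_mul _) ?_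
    filter_upwards [hs.strip] with v hv
    rw [norm_mul]
    gcongr
    exact hb v hv ω

theorem swap (hs : HedgeStep 𝓖 P μ w c d x T h) {Y : Ω → ℂ} (hY : MemLp Y 2 P) :
    Integrable (fun v => (∫ ω, stepKernel P x T h v ω * Y ω ∂P) * w v) μ ∧
      ∫ ω, stepGain P μ w x T h ω * Y ω ∂P =
        ∫ v, (∫ ω, stepKernel P x T h v ω * Y ω ∂P) * w v ∂μ := by
  obtain ⟨B, hB, hb⟩ := hs.exists_kernel_le
  refine integral_mul_integral_swap hs.weight hs.measurable_kernel hY.1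
    (hB.integrable_mul hY.norm) ?_
  filter_upwards [hs.strip] with v hv using hb v hv

theorem integral_gain_mul_affine (hs : HedgeStep 𝓖 P μ w c d x T h) {Y : Ω → ℂ}
    (hY : Measurable[𝓖] Y) (κ : ℂ)
    (hYL : MemLp (fun ω => Y ω * (1 - κ * (Complex.exp (x ω) - 1))) 2 P) :
    ∫ ω, stepGain P μ w x T h ω * (Y ω * (1 - κ * (Complex.exp (x ω) - 1))) ∂P = 0 := by
  rw [(hs.swap hYL).2]
  refine integral_eq_zero_of_ae ?_
  filter_upwards [hs.strip] with v hv
  have hT := hs.meas_T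
  have hf : Measurable[𝓖] (fun ω => h v * Complex.exp (v * T ω) * Y ω) :=
    (((Complex.measurable_exp.comp ((Complex.measurable_ofReal.comp hT).const_mul v)).const_mul
      (h v)).mul hY)
  have hq : Measurable (fun r : ℝ =>
      hedgeResidual P x v r * (1 - κ * (Complex.exp r - 1))) :=
    ((measurable_residual hs.meas_x).comp measurable_prodMk_left).mul (by fun_prop)
  have hprod := (indepFun_of_indep_comap hs.indep hf hq).integral_fun_mul_eq_mul_integral
    (hf.mono hs.sub_le le_rfl).aestronglyMeasurable (hq.comp hs.meas_x).aestronglyMeasurable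
  rw [hs.integral_residual_mul_affine κ hv, mul_zero] at hprod
  simp only [Pi.zero_apply, mul_eq_zero]
  left
  rw [← hprod]
  refine integral_congr_ae (Filter.Eventually.of_forall fun ω => ?_)
  simp only [stepKernel]
  ring

theorem integrable_covariance_inner (hs : HedgeStep 𝓖 P μ w c d x T h) {y : ℂ}
    (hy : y.re ∈ Set.Icc c d) :
    Integrable (fun z => (∫ ω, stepKernel P x T h y ω * stepKernel P x T h z ω ∂P) * w z) μ := by
  simpa only [mul_comm] using (hs.swap (hs.memLp_kernel hy)).1

theorem integral_gain_sq (hs : HedgeStep 𝓖 P μ w c d x T h) :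
    Integrable (fun y =>
      (∫ z, (∫ ω, stepKernel P x T h y ω * stepKernel P x T h z ω ∂P) * w z ∂μ) * w y) μ ∧
    ∫ ω, stepGain P μ w x T h ω ^ 2 ∂P =
      ∫ y, (∫ z, (∫ ω, stepKernel P x T h y ω * stepKernel P x T h z ω ∂P) * w z ∂μ) * w y ∂μ := by
  have hinner : ∀ᵐ y ∂μ, (∫ ω, stepKernel P x T h y ω * stepGain P μ w x T h ω ∂P) * w y =
      (∫ z, (∫ ω, stepKernel P x T h y ω * stepKernel P x T h z ω ∂P) * w z ∂μ) * w y := by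
    filter_upwards [hs.strip] with y hy
    have := (hs.swap (hs.memLp_kernel hy)).2
    simp only [mul_comm (stepKernel P x T h y _)]
    rw [this]
  have hsw := hs.swap hs.memLp_gain
  refine ⟨hsw.1.congr hinner, ?_⟩
  simp_rw [pow_two]
  rw [hsw.2]
  exact integral_congr_ae hinner

end HedgeStep

namespace HedgeStep

variable {Ω : Type*} {𝓖 m0 : MeasurableSpace Ω} {P : Measure Ω}
  {μ : Measure ℂ} {w : ℂ → ℂ} {c d : ℝ} {x T : Ω → ℝ} {h : ℂ → ℂ}

theorem complexMGF_one : complexMGF x P 1 = (mgf x P 1 : ℂ) := by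
  simpa using complexMGF_ofReal (X := x) (μ := P) 1

theorem complexMGF_two : complexMGF x P 2 = (mgf x P 2 : ℂ) := by
  simpa using complexMGF_ofReal (X := x) (μ := P) 2

variable [IsProbabilityMeasure P]

theorem integrable_mul_exp_mul (hw : Integrable w μ) (hstrip : ∀ᵐ v ∂μ, v.re ∈ Set.Icc c d)
    {k : ℂ → ℂ} (hk : Measurable k) {C : ℝ} (hC : ∀ v : ℂ, v.re ∈ Set.Icc c d → ‖k v‖ ≤ C)
    (t : ℝ) : Integrable (fun v => k v * Complex.exp (v * t) * w v) μ := by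
  refine (hw.norm.const_mul (C * (Real.exp (c * t) + Real.exp (d * t)))).mono'
    ((by fun_prop : AEStronglyMeasurable (fun v : ℂ => k v * Complex.exp (v * t)) μ).mul hw.1) ?_
  filter_upwards [hstrip] with v hv
  have hC0 := (norm_nonneg _).trans (hC v hv)
  rw [norm_mul, norm_mul]
  gcongr
  · exact hC v hv
  · exact norm_exp_mul_le_of_re_mem_Icc hv t

theorem gain_eq (hs : HedgeStep 𝓖 P μ w c d x T h) (ω : Ω) :
    stepGain P μ w x T h ω =
      (∫ v, h v * Complex.exp (v * (T ω + x ω : ℝ)) * w v ∂μ) -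
      (∫ v, h v * (complexMGF x P v - hedgeRatio P x v * (complexMGF x P 1 - 1)) *
        Complex.exp (v * T ω) * w v ∂μ) -
      (∫ v, h v * hedgeRatio P x v * Complex.exp (v * T ω) * w v ∂μ) *
        (Complex.exp (x ω) - 1) := by
  obtain ⟨C, hC⟩ := hs.bdd_h
  obtain ⟨C', hC'⟩ := exists_norm_le_of_re_mem_Icc hs.memLp_left hs.memLp_right hs.memLp_one
  have hm := measurable_complexMGF (P := P) hs.meas_x
  have hg := measurable_hedgeRatio (P := P) hs.meas_x
  have hh := hs.meas_h
  have hbound : ∀ v : ℂ, v.re ∈ Set.Icc c d →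
      ‖h v * (complexMGF x P v - hedgeRatio P x v * (complexMGF x P 1 - 1))‖ ≤
        C * (C' + C' * ‖complexMGF x P 1 - 1‖) := fun v hv => by
    have hC0 := (norm_nonneg _).trans (hC v hv)
    rw [norm_mul]
    gcongr
    · exact hC v hv
    · refine (norm_sub_le _ _).trans ?_
      rw [norm_mul]
      gcongr
      · exact (hC' v hv).1
      · exact (hC' v hv).2
  have hbound' : ∀ v : ℂ, v.re ∈ Set.Icc c d → ‖h v * hedgeRatio P x v‖ ≤ C * C' := fun v hv => by
    have hC0 := (norm_nonneg _).trans (hC v hv)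
    rw [norm_mul]
    gcongr
    · exact hC v hv
    · exact (hC' v hv).2
  have i1 := integrable_mul_exp_mul hs.weight hs.strip hh hC (T ω + x ω)
  have i2 := integrable_mul_exp_mul hs.weight hs.strip (by fun_prop) hbound (T ω)
  have i3 := integrable_mul_exp_mul hs.weight hs.strip (by fun_prop) hbound' (T ω)
  rw [← integral_mul_const, ← integral_sub i1 i2]
  refine Eq.trans ?_ (integral_sub (i1.sub i2) (i3.mul_const _))
  refine integral_congr_ae (Filter.Eventually.of_forall fun v => ?_)
  simp only [stepKernel, hedgeResidual, Complex.ofReal_add, mul_add, Complex.exp_add]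
  ring

theorem im_integral_mul_integral_exp_eq_zero [IsFiniteMeasure μ]
    (hs : HedgeStep 𝓖 P μ w c d x T h)
    (hreal : ∀ t : ℝ, (∫ v, h v * Complex.exp (v * t) * w v ∂μ).im = 0)
    {Q : Ω → ℝ} (hQ : MemLp Q 2 P) {k : ℂ → ℂ}
    (hk : ∀ v : ℂ, v.re ∈ Set.Icc c d → ∫ ω, Complex.exp (v * x ω) * (Q ω : ℂ) ∂P = k v) (t : ℝ) :
    (∫ v, h v * k v * Complex.exp (v * t) * w v ∂μ).im = 0 := by
  obtain ⟨C, hC⟩ := hs.bdd_h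
  have hx := hs.meas_x
  have hh := hs.meas_h
  set K : ℂ → Ω → ℂ := fun v ω => h v * Complex.exp (v * (t + x ω : ℝ)) with hKdef
  have hK : Measurable (Function.uncurry K) := by
    simp only [hKdef, Function.uncurry_def]
    fun_prop
  have hB : MemLp (fun ω => C * (Real.exp (c * t) * Real.exp (c * x ω) +
      Real.exp (d * t) * Real.exp (d * x ω))) 2 P :=
    ((hs.memLp_left.const_mul _).add (hs.memLp_right.const_mul _)).const_mul C
  have hsw := (integral_mul_integral_swap (Y := fun ω => (Q ω : ℂ)) hs.weight hK
    hQ.ofReal.1 (hB.integrable_mul hQ.ofReal.norm) (by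
      filter_upwards [hs.strip] with v hv ω
      have hC0 := (norm_nonneg _).trans (hC v hv)
      simp only [hKdef, norm_mul]
      rw [← Real.exp_add, ← Real.exp_add, ← mul_add, ← mul_add]
      gcongr
      · exact hC v hv
      · exact norm_exp_mul_le_of_re_mem_Icc hv _)).2
  have hrhs : ∫ v, h v * k v * Complex.exp (v * t) * w v ∂μ =
      ∫ v, (∫ ω, K v ω * (Q ω : ℂ) ∂P) * w v ∂μ := by
    refine integral_congr_ae ?_
    filter_upwards [hs.strip] with v hv
    rw [← hk v hv]
    congr 1
    rw [mul_right_comm, ← integral_const_mul]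
    refine integral_congr_ae (Filter.Eventually.of_forall fun ω => ?_)
    simp only [hKdef, Complex.ofReal_add, mul_add, Complex.exp_add]
    ring
  have hlhs : ∀ ω, (∫ v, K v ω * w v ∂μ) * (Q ω : ℂ) =
      (((∫ v, K v ω * w v ∂μ).re * Q ω : ℝ) : ℂ) := fun ω => by
    rw [Complex.ofReal_mul]
    congr 1
    exact Complex.ext (by simp) (hreal (t + x ω))
  rw [hrhs, ← hsw, integral_congr_ae (Filter.Eventually.of_forall hlhs), integral_complex_ofReal,
    Complex.ofReal_im]

theorem integral_exp_mul_regressor (hs : HedgeStep 𝓖 P μ w c d x T h) {v : ℂ}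
    (hv : v.re ∈ Set.Icc c d) :
    ∫ ω, Complex.exp (v * x ω) *
      (((Real.exp (x ω) - mgf x P 1) / (mgf x P 2 - mgf x P 1 ^ 2) : ℝ) : ℂ) ∂P =
        hedgeRatio P x v := by
  have hL := memLp_exp_mul hs.meas_x hs.memLp_left hs.memLp_right hv
  have i1 : Integrable (fun ω => Complex.exp (v * x ω)) P := hL.integrable one_le_two
  have i2 : Integrable (fun ω => Complex.exp (v * x ω) * Complex.exp (x ω)) P :=
    hL.integrable_mul (memLp_cexp hs.meas_x hs.memLp_one)
  have e : ∀ ω, Complex.exp (v * x ω) *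
      (((Real.exp (x ω) - mgf x P 1) / (mgf x P 2 - mgf x P 1 ^ 2) : ℝ) : ℂ) =
      (Complex.exp (v * x ω) * Complex.exp (x ω) - complexMGF x P 1 * Complex.exp (v * x ω)) /
        (complexMGF x P 2 - complexMGF x P 1 ^ 2) := fun ω => by
    rw [complexMGF_one, complexMGF_two]
    push_cast
    ring
  simp_rw [e]
  rw [integral_div, integral_sub i2 (i1.const_mul _), integral_const_mul, hedgeRatio]
  simp [complexMGF, add_mul, Complex.exp_add]

theorem memLp_regressor (hs : HedgeStep 𝓖 P μ w c d x T h) :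
    MemLp (fun ω => (Real.exp (x ω) - mgf x P 1) / (mgf x P 2 - mgf x P 1 ^ 2)) 2 P := by
  simp only [div_eq_mul_inv]
  exact (hs.memLp_one.sub (memLp_const _)).mul_const _

theorem im_ratio_eq_zero [IsFiniteMeasure μ] (hs : HedgeStep 𝓖 P μ w c d x T h)
    (hreal : ∀ t : ℝ, (∫ v, h v * Complex.exp (v * t) * w v ∂μ).im = 0) (t : ℝ) :
    (∫ v, h v * hedgeRatio P x v * Complex.exp (v * t) * w v ∂μ).im = 0 :=
  hs.im_integral_mul_integral_exp_eq_zero hreal hs.memLp_regressor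
    (fun _ hv => hs.integral_exp_mul_regressor hv) t

theorem im_value_eq_zero [IsFiniteMeasure μ] (hs : HedgeStep 𝓖 P μ w c d x T h)
    (hreal : ∀ t : ℝ, (∫ v, h v * Complex.exp (v * t) * w v ∂μ).im = 0) (t : ℝ) :
    (∫ v, h v * (complexMGF x P v - hedgeRatio P x v * (complexMGF x P 1 - 1)) *
      Complex.exp (v * t) * w v ∂μ).im = 0 := by
  refine hs.im_integral_mul_integral_exp_eq_zero hreal
    (Q := fun ω => 1 - (Real.exp (x ω) - mgf x P 1) / (mgf x P 2 - mgf x P 1 ^ 2) *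
      (mgf x P 1 - 1)) ((memLp_const 1).sub (hs.memLp_regressor.mul_const _)) (fun v hv => ?_) t
  have hL := memLp_exp_mul hs.meas_x hs.memLp_left hs.memLp_right hv
  have i1 : Integrable (fun ω => Complex.exp (v * x ω)) P := hL.integrable one_le_two
  have i2 : Integrable (fun ω => Complex.exp (v * x ω) *
      (((Real.exp (x ω) - mgf x P 1) / (mgf x P 2 - mgf x P 1 ^ 2) : ℝ) : ℂ)) P :=
    hL.integrable_mul hs.memLp_regressor.ofReal
  rw [← hs.integral_exp_mul_regressor hv, complexMGF, ← integral_mul_const,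
    ← integral_sub i1 (i2.mul_const _)]
  refine integral_congr_ae (Filter.Eventually.of_forall fun ω => ?_)
  simp only [complexMGF_one]
  push_cast
  ring

/-- Propagation of the second moment of the hedging error over one period. -/
theorem integral_error_sq [IsFiniteMeasure μ] (hs : HedgeStep 𝓖 P μ w c d x T h)
    (hvar : mgf x P 1 ^ 2 < mgf x P 2) {e L : Ω → ℝ} (he : Measurable[𝓖] e) (heL : MemLp e 2 P)
    (hL : ∀ ω, (L ω : ℂ) = stepGain P μ w x T h ω) {κ : ℝ}
    (hκ : κ = (mgf x P 1 - 1) / (mgf x P 2 - 2 * mgf x P 1 + 1)) :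
    MemLp (fun ω => e ω * (1 - κ * (Real.exp (x ω) - 1)) + L ω) 2 P ∧
      ∫ ω, (e ω * (1 - κ * (Real.exp (x ω) - 1)) + L ω) ^ 2 ∂P =
        (mgf x P 2 - mgf x P 1 ^ 2) / (mgf x P 2 - 2 * mgf x P 1 + 1) * ∫ ω, e ω ^ 2 ∂P +
          ∫ ω, L ω ^ 2 ∂P := by
  have hLL : MemLp L 2 P := by
    have hre : L = fun ω => (stepGain P μ w x T h ω).re := funext fun ω => by rw [← hL]; simp
    exact hre ▸ hs.memLp_gain.re
  have hqm : Measurable (fun r : ℝ => 1 - κ * (Real.exp r - 1)) := by fun_prop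
  have hqL : MemLp (fun ω => 1 - κ * (Real.exp (x ω) - 1)) 2 P :=
    (memLp_const 1).sub ((hs.memLp_one.sub (memLp_const 1)).const_mul κ)
  have hind := indepFun_of_indep_comap hs.indep he hqm
  have hprodL := hind.memLp_two_mul heL hqL
  refine ⟨hprodL.add hLL, ?_⟩
  have hcross : ∫ ω, L ω * (e ω * (1 - κ * (Real.exp (x ω) - 1))) ∂P = 0 := by
    have := hs.integral_gain_mul_affine (Complex.measurable_ofReal.comp he) (κ : ℂ) (by
      simpa using hprodL.ofReal (K := ℂ))
    rw [← Complex.ofReal_eq_zero, ← integral_complex_ofReal, ← this]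
    refine integral_congr_ae (Filter.Eventually.of_forall fun ω => ?_)
    simp [← hL]
  have hsq : ∫ ω, (1 - κ * (Real.exp (x ω) - 1)) ^ 2 ∂P =
      (mgf x P 2 - mgf x P 1 ^ 2) / (mgf x P 2 - 2 * mgf x P 1 + 1) := by
    have i1 : Integrable (fun ω => Real.exp (x ω)) P := hs.memLp_one.integrable one_le_two
    have i2 : Integrable (fun ω => Real.exp (x ω) ^ 2) P := hs.memLp_one.integrable_sq
    have e1 : ∀ ω, (1 - κ * (Real.exp (x ω) - 1)) ^ 2 =
        (1 + κ) ^ 2 - 2 * κ * (1 + κ) * Real.exp (x ω) + κ ^ 2 * Real.exp (x ω) ^ 2 :=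
      fun ω => by ring
    have i3 : Integrable (fun ω => (1 + κ) ^ 2 - 2 * κ * (1 + κ) * Real.exp (x ω)) P :=
      (integrable_const _).sub (i1.const_mul _)
    have m1 : ∫ ω, Real.exp (x ω) ∂P = mgf x P 1 := by simp [mgf]
    have m2 : ∫ ω, Real.exp (x ω) ^ 2 ∂P = mgf x P 2 := by
      simp [mgf, two_mul, Real.exp_add, pow_two]
    simp_rw [e1]
    rw [integral_add i3 (i2.const_mul _),
      integral_sub (integrable_const _) (i1.const_mul _), integral_const_mul, integral_const_mul,
      m1, m2]
    have hne : mgf x P 2 - 2 * mgf x P 1 + 1 ≠ 0 := by nlinarith [sq_nonneg (mgf x P 1 - 1)]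
    simp only [integral_const, probReal_univ, one_smul]
    have hκD : κ * (mgf x P 2 - 2 * mgf x P 1 + 1) = mgf x P 1 - 1 := by
      rw [hκ, div_mul_cancel₀ _ hne]
    rw [eq_div_iff hne]
    linear_combination
      (1 - mgf x P 1 + κ * (mgf x P 2 - 2 * mgf x P 1 + 1)) * hκD
  have hfirst : ∫ ω, (e ω * (1 - κ * (Real.exp (x ω) - 1))) ^ 2 ∂P =
      (mgf x P 2 - mgf x P 1 ^ 2) / (mgf x P 2 - 2 * mgf x P 1 + 1) * ∫ ω, e ω ^ 2 ∂P := by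
    have := (indepFun_of_indep_comap hs.indep (he.pow_const 2)
      (hqm.pow_const 2)).integral_fun_mul_eq_mul_integral heL.integrable_sq.1 hqL.integrable_sq.1
    simp_rw [mul_pow]
    rw [this, hsq, mul_comm]
  have e2 : ∀ ω, (e ω * (1 - κ * (Real.exp (x ω) - 1)) + L ω) ^ 2 =
      (e ω * (1 - κ * (Real.exp (x ω) - 1))) ^ 2 +
        2 * (L ω * (e ω * (1 - κ * (Real.exp (x ω) - 1)))) + L ω ^ 2 := fun ω => by ring
  have j1 := hprodL.integrable_sq
  have j2 : Integrable (fun ω => L ω * (e ω * (1 - κ * (Real.exp (x ω) - 1)))) P :=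
    hLL.integrable_mul hprodL
  have j3 : Integrable (fun ω => (e ω * (1 - κ * (Real.exp (x ω) - 1))) ^ 2 +
      2 * (L ω * (e ω * (1 - κ * (Real.exp (x ω) - 1))))) P := j1.add (j2.const_mul 2)
  simp_rw [e2]
  rw [integral_add j3 hLL.integrable_sq,
    integral_add j1 (j2.const_mul 2), integral_const_mul, hcross, hfirst]
  ring

end HedgeStep

theorem measurable_integral_mul_exp {μ : Measure ℂ} [IsFiniteMeasure μ] {w h : ℂ → ℂ}
    (hw : AEStronglyMeasurable w μ) (hh : Measurable h) :
    Measurable (fun t : ℝ => ∫ v, h v * Complex.exp (v * t) * w v ∂μ) := by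
  have e : (fun t : ℝ => ∫ v, h v * Complex.exp (v * t) * w v ∂μ) =
      fun t : ℝ => ∫ v, h v * Complex.exp (v * t) * hw.mk w v ∂μ := by
    funext t
    refine integral_congr_ae ?_
    filter_upwards [hw.ae_eq_mk] with v hv
    rw [hv]
  have hm : Measurable (hw.mk w) := hw.stronglyMeasurable_mk.measurable
  rw [e]
  have : StronglyMeasurable (fun p : ℝ × ℂ => h p.2 * Complex.exp (p.2 * p.1) * hw.mk w p.2) :=
    Measurable.stronglyMeasurable (by fun_prop)
  exact this.integral_prod_right.measurable

theorem integral_integral_sum_mul {ι : Type*} (s : Finset ι) {μ : Measure ℂ} {w : ℂ → ℂ}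
    (A : ι → ℂ) {F : ι → ℂ → ℂ → ℂ}
    (hin : ∀ k ∈ s, ∀ᵐ y ∂μ, Integrable (fun z => F k y z * w z) μ)
    (hout : ∀ k ∈ s, Integrable (fun y => (∫ z, F k y z * w z ∂μ) * w y) μ) :
    ∫ y, (∫ z, (∑ k ∈ s, A k * F k y z) * w z ∂μ) * w y ∂μ =
      ∑ k ∈ s, A k * ∫ y, (∫ z, F k y z * w z ∂μ) * w y ∂μ := by
  have hin' : ∀ᵐ y ∂μ, ∀ k ∈ s, Integrable (fun z => F k y z * w z) μ :=
    (Filter.eventually_all_finset s).2 hin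
  have e : ∀ᵐ y ∂μ, (∫ z, (∑ k ∈ s, A k * F k y z) * w z ∂μ) * w y =
      ∑ k ∈ s, A k * ((∫ z, F k y z * w z ∂μ) * w y) := by
    filter_upwards [hin'] with y hy
    simp_rw [Finset.sum_mul, mul_assoc]
    rw [integral_finsetSum _ fun k hk => (hy k hk).const_mul _, Finset.sum_mul]
    simp_rw [integral_const_mul, mul_assoc]
  rw [integral_congr_ae e, integral_finsetSum _ fun k hk => (hout k hk).const_mul _]
  simp_rw [integral_const_mul]

theorem exists_norm_prod_le {ι : Type*} (s : Finset ι) {p : ℂ → Prop} {f : ι → ℂ → ℂ}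
    (hf : ∀ i ∈ s, ∃ C, ∀ v, p v → ‖f i v‖ ≤ C) : ∃ C, ∀ v, p v → ‖∏ i ∈ s, f i v‖ ≤ C := by
  choose! C hC using hf
  refine ⟨∏ i ∈ s, C i, fun v hv => ?_⟩
  rw [norm_prod]
  exact Finset.prod_le_prod (fun _ _ => norm_nonneg _) fun i hi => hC i hi v hv

section IndependentIncrements

variable {Ω : Type*} {m0 : MeasurableSpace Ω} {P : Measure Ω} [IsProbabilityMeasure P]
  {N : ℕ} {𝓕 : Filtration ℕ m0} {X : ℕ → Ω → ℝ}

theorem integrable_exp_left_right (hX : ∀ n, Measurable (X n)) (hXad : StronglyAdapted 𝓕 X)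
    {n : ℕ} (hind : Indep (𝓕 n)
      (MeasurableSpace.comap (fun ω => X (n + 1) ω - X n ω) inferInstance) P) {r : ℝ}
    (hint : Integrable (fun ω => Real.exp (r * X (n + 1) ω)) P) :
    Integrable (fun ω => Real.exp (r * X n ω)) P ∧
      Integrable (fun ω => Real.exp (r * (X (n + 1) ω - X n ω))) P := by
  have hXn := hX n
  have hXn1 := hX (n + 1)
  have hif : IndepFun (fun ω => Real.exp (r * X n ω))
      (fun ω => Real.exp (r * (X (n + 1) ω - X n ω))) P :=
    indepFun_of_indep_comap (q := fun y : ℝ => Real.exp (r * y)) hind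
      (Real.measurable_exp.comp ((hXad n).measurable.const_mul r)) (by fun_prop)
  have hprod : Integrable (fun ω => Real.exp (r * X n ω) *
      Real.exp (r * (X (n + 1) ω - X n ω))) P := by
    refine hint.congr (Filter.Eventually.of_forall fun ω => ?_)
    simp only [← Real.exp_add]
    congr 1
    ring
  have hne : ∀ f : Ω → ℝ, ¬ (fun ω => Real.exp (f ω)) =ᵐ[P] 0 := fun f hf => by
    obtain ⟨ω, hω⟩ := hf.exists
    exact (Real.exp_pos (f ω)).ne' hω
  constructor
  · exact hif.integrable_left_of_integrable_op (· * ·) 1 one_ne_zero (by simp [enorm_mul]) hprod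
      (by fun_prop) (by fun_prop) (hne _)
  · exact hif.integrable_right_of_integrable_op (· * ·) 1 one_ne_zero (by simp [enorm_mul]) hprod
      (by fun_prop) (by fun_prop) (hne _)

theorem integrable_exp_of_le (hX : ∀ n, Measurable (X n)) (hXad : StronglyAdapted 𝓕 X)
    (hind : ∀ n < N, Indep (𝓕 n)
      (MeasurableSpace.comap (fun ω => X (n + 1) ω - X n ω) inferInstance) P) {r : ℝ}
    (hint : Integrable (fun ω => Real.exp (r * X N ω)) P) {n : ℕ} (hn : n ≤ N) :
    Integrable (fun ω => Real.exp (r * X n ω)) P := by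
  induction hn using Nat.decreasingInduction with
  | self => exact hint
  | of_succ k hk ih => exact (integrable_exp_left_right hX hXad (hind k hk) ih).1

theorem complexMGF_const_add (hX : ∀ n, Measurable (X n)) (hX0 : ∀ ω, X 0 ω = 0)
    (hXad : StronglyAdapted 𝓕 X)
    (hind : ∀ n < N, Indep (𝓕 n)
      (MeasurableSpace.comap (fun ω => X (n + 1) ω - X n ω) inferInstance) P)
    (t : ℝ) (v : ℂ) {n : ℕ} (hn : n ≤ N) :
    complexMGF (fun ω => t + X n ω) P v = Complex.exp (v * t) *
      ∏ l ∈ Finset.Icc 2 (n + 1), complexMGF (fun ω => X (l - 1) ω - X (l - 1 - 1) ω) P v := by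
  induction n with
  | zero => simp [complexMGF, hX0]
  | succ k ih =>
    rw [Finset.prod_Icc_succ_top (by omega), ← mul_assoc, ← ih (by omega)]
    have hXk := hX k
    have hXk1 := hX (k + 1)
    have hif : IndepFun (fun ω => Complex.exp (v * (t + X k ω : ℝ)))
        (fun ω => Complex.exp (v * (X (k + 1) ω - X k ω : ℝ))) P :=
      indepFun_of_indep_comap (q := fun y : ℝ => Complex.exp (v * y)) (hind k (by omega))
        (Complex.measurable_exp.comp ((Complex.measurable_ofReal.comp
          ((hXad k).measurable.const_add t)).const_mul v)) (by fun_prop)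
    have := hif.integral_fun_mul_eq_mul_integral (by fun_prop) (by fun_prop)
    simp only [complexMGF, Nat.add_sub_cancel]
    rw [← this]
    refine integral_congr_ae (Filter.Eventually.of_forall fun ω => ?_)
    simp only [← Complex.exp_add]
    congr 1
    push_cast
    ring

end IndependentIncrements

theorem IsCompact.exists_subset_Icc {I : Set ℝ} (hI : IsCompact I) {p : ℝ → Prop}
    (hp : ∀ x ∈ I, p x) (h0 : p 0) : ∃ c d, p c ∧ p d ∧ I ⊆ Set.Icc c d := by
  rcases I.eq_empty_or_nonempty with rfl | hne
  · exact ⟨0, 0, h0, h0, Set.empty_subset _⟩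
  · obtain ⟨c, hc⟩ := hI.exists_isLeast hne
    obtain ⟨d, hd⟩ := hI.exists_isGreatest hne
    exact ⟨c, d, hp c hc.1, hp d hd.1, fun x hx => ⟨hc.2 hx, hd.2 hx⟩⟩

/-- The coefficient `h(v, n)` of `S_n ^ v` in the value process of the claim `S_N ^ v`. -/
noncomputable def valueCoeff {Ω : Type*} {m0 : MeasurableSpace Ω} (P : Measure Ω) (X : ℕ → Ω → ℝ)
    (N : ℕ) (v : ℂ) (n : ℕ) : ℂ :=
  ∏ i ∈ Finset.Icc (n + 1) N, (complexMGF (fun ω => X i ω - X (i - 1) ω) P v -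
    hedgeRatio P (fun ω => X i ω - X (i - 1) ω) v *
      (complexMGF (fun ω => X i ω - X (i - 1) ω) P 1 - 1))

section ExponentialPII

variable {Ω : Type*} {m0 : MeasurableSpace Ω} {P : Measure Ω} {N : ℕ} {X : ℕ → Ω → ℝ}

theorem valueCoeff_self (v : ℂ) : valueCoeff P X N v N = 1 := by
  simp [valueCoeff]

theorem valueCoeff_eq_mul (v : ℂ) {n : ℕ} (hn : n < N) :
    valueCoeff P X N v n = valueCoeff P X N v (n + 1) *
      (complexMGF (fun ω => X (n + 1) ω - X n ω) P v -
        hedgeRatio P (fun ω => X (n + 1) ω - X n ω) v *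
          (complexMGF (fun ω => X (n + 1) ω - X n ω) P 1 - 1)) := by
  rw [valueCoeff, valueCoeff, ← Finset.insert_Icc_add_one_left_eq_Icc (show n + 1 ≤ N from hn),
    Finset.prod_insert (by simp), mul_comm]
  rfl

theorem measurable_valueCoeff [IsProbabilityMeasure P] (hX : ∀ n, Measurable (X n)) (n : ℕ) :
    Measurable (fun v => valueCoeff P X N v n) := by
  unfold valueCoeff
  refine Finset.measurable_fun_prod _ fun i _ => ?_
  have hx : Measurable (fun ω => X i ω - X (i - 1) ω) := (hX i).sub (hX (i - 1))
  exact (measurable_complexMGF hx).sub ((measurable_hedgeRatio hx).mul_const _)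

theorem memLp_two_exp_mul {f : Ω → ℝ} (hf : Measurable f) {r : ℝ}
    (h : Integrable (fun ω => Real.exp (2 * r * f ω)) P) :
    MemLp (fun ω => Real.exp (r * f ω)) 2 P := by
  refine (memLp_two_iff_integrable_sq (by fun_prop)).2 (h.congr (.of_forall fun ω => ?_))
  simp only [← Real.exp_nat_mul]
  congr 1
  push_cast
  ring

variable [IsProbabilityMeasure P] {𝓕 : Filtration ℕ m0}

theorem hedgeStep_increment (hX : ∀ n, Measurable (X n)) (hXad : StronglyAdapted 𝓕 X)
    (hind : ∀ n < N, Indep (𝓕 n)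
      (MeasurableSpace.comap (fun ω => X (n + 1) ω - X n ω) inferInstance) P)
    (hne : ∀ n < N, ¬ ∃ k : ℝ, (fun ω => X (n + 1) ω - X n ω) =ᵐ[P] fun _ => k)
    {μ : Measure ℂ} {w : ℂ → ℂ} (hw : Integrable w μ) {c d : ℝ}
    (hstrip : ∀ᵐ v ∂μ, v.re ∈ Set.Icc c d)
    (hc : Integrable (fun ω => Real.exp (2 * c * X N ω)) P)
    (hd : Integrable (fun ω => Real.exp (2 * d * X N ω)) P)
    (h2 : Integrable (fun ω => Real.exp (2 * 1 * X N ω)) P) (t : ℝ) {n : ℕ} (hn : n < N) :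
    HedgeStep (𝓕 n) P μ w c d (fun ω => X (n + 1) ω - X n ω) (fun ω => t + X n ω)
      (fun v => valueCoeff P X N v (n + 1)) ∧
    mgf (fun ω => X (n + 1) ω - X n ω) P 1 ^ 2 < mgf (fun ω => X (n + 1) ω - X n ω) P 2 := by
  have hx : ∀ n, Measurable (fun ω => X (n + 1) ω - X n ω) := fun n => (hX (n + 1)).sub (hX n)
  have key : ∀ {r : ℝ}, Integrable (fun ω => Real.exp (2 * r * X N ω)) P → ∀ k < N,
      MemLp (fun ω => Real.exp (r * (X (k + 1) ω - X k ω))) 2 P ∧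
        MemLp (fun ω => Real.exp (r * (t + X k ω))) 2 P := fun {r} hr k hk => by
    have h := integrable_exp_left_right hX hXad (hind k hk)
      (integrable_exp_of_le hX hXad hind hr (Nat.succ_le_of_lt hk))
    refine ⟨memLp_two_exp_mul (hx k) h.2, ?_⟩
    simp_rw [mul_add, Real.exp_add]
    exact (memLp_two_exp_mul (hX k) h.1).const_mul _
  have key1 : ∀ k < N, MemLp (fun ω => Real.exp (X (k + 1) ω - X k ω)) 2 P := fun k hk => by
    simpa using (key h2 k hk).1
  have hvar := mgf_one_sq_lt_mgf_two (key1 n hn) (hne n hn)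
  refine ⟨?_, hvar⟩
  refine
    { weight := hw
      strip := hstrip
      meas_x := hx n
      memLp_left := (key hc n hn).1
      memLp_right := (key hd n hn).1
      memLp_one := key1 n hn
      var_ne := ?_
      sub_le := 𝓕.le n
      meas_T := (hXad n).measurable.const_add t
      indep := hind n hn
      memLp_left_T := (key hc n hn).2
      memLp_right_T := (key hd n hn).2
      meas_h := measurable_valueCoeff hX (n + 1)
      bdd_h := ?_ }
  · have e1 := complexMGF_ofReal (X := fun ω => X (n + 1) ω - X n ω) (μ := P) 1
    have e2 := complexMGF_ofReal (X := fun ω => X (n + 1) ω - X n ω) (μ := P) 2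
    push_cast at e1 e2
    rw [e1, e2]
    exact_mod_cast (sub_pos.2 hvar).ne'
  · refine exists_norm_prod_le _ fun i hi => ?_
    obtain ⟨k, rfl⟩ : ∃ k, i = k + 1 := ⟨i - 1, by have := (Finset.mem_Icc.1 hi).1; omega⟩
    have hk : k < N := (Finset.mem_Icc.1 hi).2
    obtain ⟨C, hC⟩ := exists_norm_le_of_re_mem_Icc (key hc k hk).1 (key hd k hk).1 (key1 k hk)
    refine ⟨C + C * ‖complexMGF (fun ω => X (k + 1) ω - X k ω) P 1 - 1‖, fun v hv => ?_⟩
    refine (norm_sub_le _ _).trans (add_le_add (hC v hv).1 ?_)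
    rw [norm_mul]
    exact mul_le_mul_of_nonneg_right (hC v hv).2 (norm_nonneg _)

theorem im_integral_valueCoeff_eq_zero {μ : Measure ℂ} [IsFiniteMeasure μ] {w : ℂ → ℂ} {c d t₀ : ℝ}
    (hs : ∀ n < N, HedgeStep (𝓕 n) P μ w c d (fun ω => X (n + 1) ω - X n ω) (fun ω => t₀ + X n ω)
      (fun v => valueCoeff P X N v (n + 1)))
    (hreal : ∀ t : ℝ, (∫ v, Complex.exp (v * t) * w v ∂μ).im = 0) {n : ℕ} (hn : n ≤ N) (t : ℝ) :
    (∫ v, valueCoeff P X N v n * Complex.exp (v * t) * w v ∂μ).im = 0 := by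
  induction hn using Nat.decreasingInduction generalizing t with
  | self => simpa only [valueCoeff_self, one_mul] using hreal t
  | of_succ k hk ih =>
    simp_rw [valueCoeff_eq_mul _ hk]
    exact (hs k hk).im_value_eq_zero ih t

theorem integral_error_sq_eq_sum {μ : Measure ℂ} [IsFiniteMeasure μ] {w : ℂ → ℂ} {c d t₀ : ℝ}
    (hs : ∀ n < N, HedgeStep (𝓕 n) P μ w c d (fun ω => X (n + 1) ω - X n ω) (fun ω => t₀ + X n ω)
      (fun v => valueCoeff P X N v (n + 1)))
    (hvar : ∀ n < N, mgf (fun ω => X (n + 1) ω - X n ω) P 1 ^ 2 <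
      mgf (fun ω => X (n + 1) ω - X n ω) P 2)
    (hXad : StronglyAdapted 𝓕 X) {e L : ℕ → Ω → ℝ} {κ A : ℕ → ℝ}
    (hκ : ∀ n < N, κ (n + 1) = (mgf (fun ω => X (n + 1) ω - X n ω) P 1 - 1) /
      (mgf (fun ω => X (n + 1) ω - X n ω) P 2 - 2 * mgf (fun ω => X (n + 1) ω - X n ω) P 1 + 1))
    (hA : ∀ n < N, A (n + 1) = (mgf (fun ω => X (n + 1) ω - X n ω) P 2 -
      mgf (fun ω => X (n + 1) ω - X n ω) P 1 ^ 2) /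
      (mgf (fun ω => X (n + 1) ω - X n ω) P 2 - 2 * mgf (fun ω => X (n + 1) ω - X n ω) P 1 + 1))
    (hL : ∀ n < N, ∀ ω, (L (n + 1) ω : ℂ) = stepGain P μ w (fun ω => X (n + 1) ω - X n ω)
      (fun ω => t₀ + X n ω) (fun v => valueCoeff P X N v (n + 1)) ω)
    (hLm : ∀ n < N, Measurable[𝓕 (n + 1)] (L (n + 1)))
    (he0 : ∀ ω, e 0 ω = 0)
    (he : ∀ n < N, ∀ ω, e (n + 1) ω =
      e n ω * (1 - κ (n + 1) * (Real.exp (X (n + 1) ω - X n ω) - 1)) + L (n + 1) ω)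
    {n : ℕ} (hn : n ≤ N) :
    Measurable[𝓕 n] (e n) ∧ MemLp (e n) 2 P ∧ ∫ ω, e n ω ^ 2 ∂P =
      ∑ k ∈ Finset.Icc 1 n, (∏ j ∈ Finset.Icc (k + 1) n, A j) * ∫ ω, L k ω ^ 2 ∂P := by
  induction n with
  | zero =>
    have : e 0 = fun _ => 0 := funext he0
    rw [this]
    exact ⟨measurable_const, MemLp.zero, by simp⟩
  | succ n ih =>
    obtain ⟨ihm, ihL, ihs⟩ := ih (by omega)
    have heq : e (n + 1) = fun ω =>
        e n ω * (1 - κ (n + 1) * (Real.exp (X (n + 1) ω - X n ω) - 1)) + L (n + 1) ω :=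
      funext (he n hn)
    obtain ⟨hmem, hint⟩ := (hs n hn).integral_error_sq (hvar n hn) ihm ihL (hL n hn) (hκ n hn)
    rw [heq]
    refine ⟨?_, hmem, ?_⟩
    · have h1 : Measurable[𝓕 (n + 1)] (e n) := ihm.mono (𝓕.mono n.le_succ) le_rfl
      have h2 : Measurable[𝓕 (n + 1)] (X n) :=
        (hXad n).measurable.mono (𝓕.mono n.le_succ) le_rfl
      have h3 : Measurable[𝓕 (n + 1)] (X (n + 1)) := (hXad (n + 1)).measurable
      have h4 := hLm n hn
      exact (h1.mul (((Real.measurable_exp.comp (h3.sub h2)).sub_const 1).const_mul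
        (κ (n + 1)) |>.const_sub 1)).add h4
    · rw [hint, ihs, Finset.sum_Icc_succ_top (by omega), ← hA n hn, Finset.mul_sum]
      congr 1
      · refine Finset.sum_congr rfl fun k hk => ?_
        rw [Finset.prod_Icc_succ_top (by have := (Finset.mem_Icc.1 hk).2; omega)]
        ring
      · simp

end ExponentialPII

/-- Explicit variance of the optimal hedging error.  Under Assumptions A and
B (with `F₀` trivial), the minimal quadratic hedging error
`J₀ = E[(H − V₀* − Σ_{k=1}^N φ*_k ΔS_k)²]` for `H = f(S_N)` equals
`J₀ = ∫∫ J₀(y,z) Π(dy) Π(dz)`, where for `y, z ∈ supp Π`,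
`J₀(y,z) = s₀^{y+z} Σ_{k=1}^N b(y,z;k) h(z,k) h(y,k) ∏_{ℓ=2}^k m(y+z,ℓ−1) ∏_{j=k+1}^N a(j)`
and `J₀(y,z) = 0` otherwise; here `a(j) = (m(2,j) − m(1,j)²)/(m(2,j) − 2m(1,j) + 1)`,
`ρ(y,z;k) = m(y+z,k) − m(y,k)m(z,k)` and
`b(y,z;k) = (ρ(y,z;k)ρ(1,1;k) − ρ(y,1;k)ρ(z,1;k))/ρ(1,1;k)`. -/
theorem stmt_12 {Ω : Type*} {m0 : MeasurableSpace Ω} (P : Measure Ω) [IsProbabilityMeasure P]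
    (N : ℕ) (hN : 1 ≤ N) (𝓕 : Filtration ℕ m0)
    (h𝓕0 : ∀ A : Set Ω, MeasurableSet[𝓕 0] A → P A = 0 ∨ P A = 1)
    (X : ℕ → Ω → ℝ) (hXmeas : ∀ n, Measurable (X n)) (hX0 : ∀ ω, X 0 ω = 0)
    (hXadapted : StronglyAdapted 𝓕 X)
    (hindep : iIndepFun (m := fun _ : Fin N => inferInstance)
      (fun (k : Fin N) (ω : Ω) => X (k.val + 1) ω - X k.val ω) P)
    (hindep𝓕 : ∀ n, 1 ≤ n → n ≤ N →
      Indep (𝓕 (n - 1))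
        (MeasurableSpace.comap (fun ω => X n ω - X (n - 1) ω) inferInstance) P)
    (s0 : ℝ) (hs0 : 0 < s0)
    (S : ℕ → Ω → ℝ) (hS : ∀ n ω, S n ω = s0 * Real.exp (X n ω))
    (D : Set ℂ)
    (hD : D = {w : ℂ | Integrable (fun ω => Complex.exp (w * X N ω)) P})
    -- Assumption A
    (hA1 : ∀ n, 1 ≤ n → n ≤ N →
      ¬ ∃ c : ℝ, (fun ω => X n ω - X (n - 1) ω) =ᵐ[P] fun _ => c)
    (hA2 : (2 : ℂ) ∈ D)
    -- the finite complex measure Π(dz) = w(z) μ(dz) and Assumption B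
    (μ : Measure ℂ) [IsFiniteMeasure μ] (w : ℂ → ℂ) (hw : Integrable w μ)
    (I₀ : Set ℝ) (hI₀ : IsCompact I₀)
    (h2I₀ : ∀ x ∈ I₀, ((2 * x : ℝ) : ℂ) ∈ D)
    (hconc : ∀ᵐ z ∂μ, z.re ∈ I₀)
    (hreal : ∀ s : ℝ, 0 < s → (∫ v, (s : ℂ) ^ v * w v ∂μ).im = 0)
    -- the decomposition ingredients (with the vanishing convention)
    (m : ℂ → ℕ → ℂ)
    (hm : ∀ v n, m v n = ∫ ω, Complex.exp (v * (X n ω - X (n - 1) ω)) ∂P)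
    (g : ℂ → ℕ → ℂ)
    (hg : ∀ v n, ((2 * v.re : ℝ) : ℂ) ∈ D →
      g v n = (m (v + 1) n - m 1 n * m v n) / (m 2 n - (m 1 n) ^ 2))
    (hg0 : ∀ v n, ((2 * v.re : ℝ) : ℂ) ∉ D → g v n = 0)
    (h : ℂ → ℕ → ℂ)
    (hh : ∀ v n, ((2 * v.re : ℝ) : ℂ) ∈ D →
      h v n = ∏ i ∈ Finset.Icc (n + 1) N, (m v i - g v i * (m 1 i - 1)))
    (hh0 : ∀ v n, ((2 * v.re : ℝ) : ℂ) ∉ D → h v n = 0)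
    (Hz : ℂ → ℕ → Ω → ℂ)
    (hHz : ∀ v n ω, ((2 * v.re : ℝ) : ℂ) ∈ D → Hz v n ω = h v n * (S n ω : ℂ) ^ v)
    (hHz0 : ∀ v n ω, ((2 * v.re : ℝ) : ℂ) ∉ D → Hz v n ω = 0)
    (ξz : ℂ → ℕ → Ω → ℂ)
    (hξz : ∀ v n ω, ((2 * v.re : ℝ) : ℂ) ∈ D →
      ξz v n ω = g v n * h v n * (S (n - 1) ω : ℂ) ^ (v - 1))
    (hξz0 : ∀ v n ω, ((2 * v.re : ℝ) : ℂ) ∉ D → ξz v n ω = 0)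
    -- the real-valued integrated processes and payoff
    (H : Ω → ℝ) (hH : ∀ ω, H ω = (∫ v, (S N ω : ℂ) ^ v * w v ∂μ).re)
    (Hn : ℕ → Ω → ℝ) (hHn : ∀ n ω, Hn n ω = (∫ v, Hz v n ω * w v ∂μ).re)
    (ξH : ℕ → Ω → ℝ) (hξH : ∀ n ω, ξH n ω = (∫ v, ξz v n ω * w v ∂μ).re)
    (V0star : ℝ) (hV0star : ∀ ω, V0star = Hn 0 ω)
    -- λ and the recursively defined optimal strategy
    (lam : ℕ → Ω → ℝ)
    (hlam : ∀ n ω, lam n ω =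
      (1 / S (n - 1) ω) * ((m 1 n - 1) / (m 2 n - 2 * m 1 n + 1)).re)
    (φ : ℕ → Ω → ℝ)
    (hφ : ∀ n, 1 ≤ n → n ≤ N → ∀ ω, φ n ω =
      ξH n ω + lam n ω *
        (Hn (n - 1) ω - V0star -
          ∑ i ∈ Finset.Icc 1 (n - 1), φ i ω * (S i ω - S (i - 1) ω)))
    -- the ingredients of the error formula
    (a : ℕ → ℂ)
    (ha : ∀ j, a j = (m 2 j - (m 1 j) ^ 2) / (m 2 j - 2 * m 1 j + 1))
    (ρ : ℂ → ℂ → ℕ → ℂ)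
    (hρ : ∀ y z k, ρ y z k = m (y + z) k - m y k * m z k)
    (b : ℂ → ℂ → ℕ → ℂ)
    (hb : ∀ y z k, b y z k = (ρ y z k * ρ 1 1 k - ρ y 1 k * ρ z 1 k) / ρ 1 1 k)
    (J0 : ℂ → ℂ → ℂ)
    (hJ0 : ∀ y z : ℂ, y.re ∈ I₀ → z.re ∈ I₀ →
      J0 y z = (s0 : ℂ) ^ (y + z) *
        ∑ k ∈ Finset.Icc 1 N, b y z k * h z k * h y k *
          (∏ l ∈ Finset.Icc 2 k, m (y + z) (l - 1)) *
          ∏ j ∈ Finset.Icc (k + 1) N, a j)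
    (hJ0' : ∀ y z : ℂ, ¬ (y.re ∈ I₀ ∧ z.re ∈ I₀) → J0 y z = 0) :
    ((∫ ω, (H ω - V0star -
        ∑ k ∈ Finset.Icc 1 N, φ k ω * (S k ω - S (k - 1) ω)) ^ 2 ∂P : ℝ) : ℂ)
      = ∫ y, (∫ z, J0 y z * w z ∂μ) * w y ∂μ := by
  set t₀ : ℝ := Real.log s0 with ht₀
  have hSexp : ∀ n ω, S n ω = Real.exp (t₀ + X n ω) := fun n ω => by
    rw [hS, Real.exp_add, Real.exp_log hs0]
  have hSpos : ∀ n ω, 0 < S n ω := fun n ω => by rw [hSexp]; exact Real.exp_pos _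
  have hexp_cpow : ∀ (t : ℝ) (v : ℂ), ((Real.exp t : ℝ) : ℂ) ^ v = Complex.exp (v * t) :=
    fun t v => by
      rw [Complex.cpow_def_of_ne_zero (by exact_mod_cast (Real.exp_pos t).ne'),
        ← Complex.ofReal_log (Real.exp_pos t).le, Real.log_exp, mul_comm]
  have hmM : ∀ v n, m v n = complexMGF (fun ω => X n ω - X (n - 1) ω) P v := fun v n => by
    rw [hm, complexMGF]
    simp only [Complex.ofReal_sub]
  have hm1 : ∀ n, m 1 n = (mgf (fun ω => X n ω - X (n - 1) ω) P 1 : ℝ) := fun n => by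
    rw [hmM, ← complexMGF_ofReal, Complex.ofReal_one]
  have hm2 : ∀ n, m 2 n = (mgf (fun ω => X n ω - X (n - 1) ω) P 2 : ℝ) := fun n => by
    rw [hmM, ← complexMGF_ofReal, Complex.ofReal_ofNat]
  have hDre : ∀ r : ℝ, ((r : ℝ) : ℂ) ∈ D → Integrable (fun ω => Real.exp (r * X N ω)) P :=
    fun r hr => by
      rw [hD] at hr
      refine hr.norm.congr (.of_forall fun ω => ?_)
      simp [Complex.norm_exp]
  have hind : ∀ n < N, Indep (𝓕 n)
      (MeasurableSpace.comap (fun ω => X (n + 1) ω - X n ω) inferInstance) P :=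
    fun n hn => hindep𝓕 (n + 1) (by omega) hn
  have hne : ∀ n < N, ¬ ∃ k : ℝ, (fun ω => X (n + 1) ω - X n ω) =ᵐ[P] fun _ => k :=
    fun n hn => hA1 (n + 1) (by omega) hn
  obtain ⟨c, d, hc, hd, hI⟩ := hI₀.exists_subset_Icc
    (p := fun r => Integrable (fun ω => Real.exp (2 * r * X N ω)) P)
    (fun r hr => hDre _ (h2I₀ r hr)) (by simp)
  have h2 : Integrable (fun ω => Real.exp (2 * 1 * X N ω)) P :=
    hDre _ (by simpa using hA2)
  have hstrip : ∀ᵐ v ∂μ, v.re ∈ Set.Icc c d := hconc.mono fun v hv => hI hv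
  have hstep := fun n hn => hedgeStep_increment (n := n) hXmeas hXadapted hind hne hw hstrip
    hc hd h2 t₀ hn
  have hs := fun n hn => (hstep n hn).1
  have hvar := fun n hn => (hstep n hn).2
  have hgR : ∀ v : ℂ, v.re ∈ I₀ → ∀ n, g v n = hedgeRatio P (fun ω => X n ω - X (n - 1) ω) v :=
    fun v hv n => by
      rw [hg v n (h2I₀ _ hv)]
      simp only [hmM, hedgeRatio]
  have hhV : ∀ v : ℂ, v.re ∈ I₀ → ∀ n, h v n = valueCoeff P X N v n := fun v hv n => by
    rw [hh v n (h2I₀ _ hv), valueCoeff]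
    simp only [hmM, hgR v hv]
  set V : ℕ → ℝ → ℂ := fun n t => ∫ v, valueCoeff P X N v n * Complex.exp (v * t) * w v ∂μ with hV
  set G : ℕ → ℝ → ℂ := fun n t => ∫ v, valueCoeff P X N v n *
    hedgeRatio P (fun ω => X n ω - X (n - 1) ω) v * Complex.exp (v * t) * w v ∂μ with hG
  have hVreal : ∀ n ≤ N, ∀ t, (V n t).im = 0 := fun n hn t =>
    im_integral_valueCoeff_eq_zero hs (fun t => by
      simpa only [hexp_cpow] using hreal (Real.exp t) (Real.exp_pos t)) hn t
  have hGreal : ∀ n < N, ∀ t, (G (n + 1) t).im = 0 := fun n hn t =>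
    (hs n hn).im_ratio_eq_zero (hVreal (n + 1) hn) t
  have hHnV : ∀ n ω, Hn n ω = (V n (t₀ + X n ω)).re := fun n ω => by
    rw [hHn]
    congr 1
    refine integral_congr_ae ?_
    filter_upwards [hconc] with v hv
    rw [hHz v n ω (h2I₀ _ hv), hhV v hv, hSexp, hexp_cpow]
  have hξG : ∀ n ω, ξH (n + 1) ω * S n ω = (G (n + 1) (t₀ + X n ω)).re := fun n ω => by
    rw [hξH, ← Complex.re_mul_ofReal, ← integral_mul_const]
    congr 1
    refine integral_congr_ae ?_
    filter_upwards [hconc] with v hv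
    have hS0 : (S n ω : ℂ) ≠ 0 := by exact_mod_cast (hSpos n ω).ne'
    rw [hξz v (n + 1) ω (h2I₀ _ hv), hhV v hv, hgR v hv, Nat.add_sub_cancel,
      Complex.cpow_sub _ _ hS0, Complex.cpow_one, ← hexp_cpow, ← hSexp]
    field_simp
  have hHV : ∀ ω, H ω = Hn N ω := fun ω => by
    rw [hH, hHnV, hV]
    simp only [valueCoeff_self, one_mul, hSexp, hexp_cpow]
  set L : ℕ → Ω → ℝ := fun n ω => (V n (t₀ + X n ω)).re - (V (n - 1) (t₀ + X (n - 1) ω)).re -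
    (G n (t₀ + X (n - 1) ω)).re * (Real.exp (X n ω - X (n - 1) ω) - 1) with hLdef
  have hofReal : ∀ z : ℂ, z.im = 0 → ((z.re : ℝ) : ℂ) = z := fun z hz =>
    Complex.ext rfl (by simp [hz])
  have hL : ∀ n < N, ∀ ω, (L (n + 1) ω : ℂ) = stepGain P μ w (fun ω => X (n + 1) ω - X n ω)
      (fun ω => t₀ + X n ω) (fun v => valueCoeff P X N v (n + 1)) ω := fun n hn ω => by
    rw [(hs n hn).gain_eq]
    simp only [hLdef, Nat.add_sub_cancel, Complex.ofReal_sub, Complex.ofReal_mul,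
      Complex.ofReal_exp, Complex.ofReal_one]
    rw [hofReal _ (hVreal _ hn _), hofReal _ (hVreal _ hn.le _), hofReal _ (hGreal n hn _)]
    simp only [hV, hG, Nat.add_sub_cancel, valueCoeff_eq_mul _ hn]
    congr 4
    funext v
    rw [show t₀ + X n ω + (X (n + 1) ω - X n ω) = t₀ + X (n + 1) ω by ring]
  have hVm : ∀ n, Measurable (V n) := fun n =>
    measurable_integral_mul_exp hw.1 (measurable_valueCoeff hXmeas n)
  have hGm : ∀ n, Measurable (G n) := fun n =>
    measurable_integral_mul_exp hw.1 ((measurable_valueCoeff hXmeas n).mul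
      (measurable_hedgeRatio ((hXmeas n).sub (hXmeas (n - 1)))))
  have hLm : ∀ n < N, Measurable[𝓕 (n + 1)] (L (n + 1)) := fun n _ => by
    have h1 : Measurable[𝓕 (n + 1)] (X n) :=
      (hXadapted n).measurable.mono (𝓕.mono n.le_succ) le_rfl
    have h2 : Measurable[𝓕 (n + 1)] (X (n + 1)) := (hXadapted (n + 1)).measurable
    exact ((Complex.measurable_re.comp ((hVm (n + 1)).comp (h2.const_add t₀))).sub
      (Complex.measurable_re.comp ((hVm n).comp (h1.const_add t₀)))).sub
      ((Complex.measurable_re.comp ((hGm (n + 1)).comp (h1.const_add t₀))).mul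
        ((Real.measurable_exp.comp (h2.sub h1)).sub_const 1))
  set M : ℕ → ℝ → ℝ := fun n r => mgf (fun ω => X n ω - X (n - 1) ω) P r with hM
  set κ : ℕ → ℝ := fun n => (M n 1 - 1) / (M n 2 - 2 * M n 1 + 1) with hκ
  set A : ℕ → ℝ := fun n => (M n 2 - M n 1 ^ 2) / (M n 2 - 2 * M n 1 + 1) with hAdef
  have haA : ∀ j, a j = (A j : ℝ) := fun j => by
    simp only [ha, hm1, hm2, hAdef, hM]
    push_cast
    rfl
  have hlamκ : ∀ n ω, lam (n + 1) ω * S n ω = κ (n + 1) := fun n ω => by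
    have : (m 1 (n + 1) - 1) / (m 2 (n + 1) - 2 * m 1 (n + 1) + 1) = (κ (n + 1) : ℝ) := by
      simp only [hm1, hm2, hκ, hM]
      push_cast
      rfl
    rw [hlam, this, Complex.ofReal_re, Nat.add_sub_cancel]
    have := (hSpos n ω).ne'
    field_simp
  set e : ℕ → Ω → ℝ := fun n ω => Hn n ω - V0star -
    ∑ i ∈ Finset.Icc 1 n, φ i ω * (S i ω - S (i - 1) ω) with hedef
  have he : ∀ n < N, ∀ ω, e (n + 1) ω =
      e n ω * (1 - κ (n + 1) * (Real.exp (X (n + 1) ω - X n ω) - 1)) + L (n + 1) ω :=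
    fun n hn ω => by
      have hSS : S (n + 1) ω - S n ω = S n ω * (Real.exp (X (n + 1) ω - X n ω) - 1) := by
        rw [mul_sub, hSexp, hSexp, ← Real.exp_add]
        ring_nf
      have hφn := hφ (n + 1) (by omega) hn ω
      rw [Nat.add_sub_cancel] at hφn
      simp only [hedef, hLdef, Nat.add_sub_cancel]
      rw [Finset.sum_Icc_succ_top (by omega), Nat.add_sub_cancel, hSS, hφn, ← hHnV, ← hHnV,
        ← hξG, ← hlamκ n ω]
      ring
  have hsum := (integral_error_sq_eq_sum hs hvar hXadapted (κ := κ) (A := A) (fun _ _ => rfl)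
    (fun _ _ => rfl) hL hLm (fun ω => by simp [hedef, ← hV0star ω]) he le_rfl).2.2
  have hLsq : ∀ n < N, ((∫ ω, L (n + 1) ω ^ 2 ∂P : ℝ) : ℂ) =
      ∫ ω, stepGain P μ w (fun ω => X (n + 1) ω - X n ω)
        (fun ω => t₀ + X n ω) (fun v => valueCoeff P X N v (n + 1)) ω ^ 2 ∂P := fun n hn => by
    rw [← integral_complex_ofReal]
    simp only [Complex.ofReal_pow, hL n hn]
  set F : ℕ → ℂ → ℂ → ℂ := fun k y z => ∫ ω,
    stepKernel P (fun ω => X k ω - X (k - 1) ω) (fun ω => t₀ + X (k - 1) ω)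
      (fun v => valueCoeff P X N v k) y ω *
    stepKernel P (fun ω => X k ω - X (k - 1) ω) (fun ω => t₀ + X (k - 1) ω)
      (fun v => valueCoeff P X N v k) z ω ∂P with hF
  have hJF : ∀ y z : ℂ, y.re ∈ I₀ → z.re ∈ I₀ →
      J0 y z = ∑ k ∈ Finset.Icc 1 N, (∏ j ∈ Finset.Icc (k + 1) N, a j) * F k y z :=
    fun y z hy hz => by
      rw [hJ0 y z hy hz, Finset.mul_sum]
      refine Finset.sum_congr rfl fun k hk => ?_
      obtain ⟨n, rfl⟩ : ∃ n, k = n + 1 := ⟨k - 1, by have := (Finset.mem_Icc.1 hk).1; omega⟩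
      have hn : n < N := (Finset.mem_Icc.1 hk).2
      have hsn := hs n hn
      have hcov := hsn.integral_kernel_mul_kernel y z
      rw [integral_residual_mul_residual hsn.meas_x hsn.memLp_left hsn.memLp_right hsn.memLp_one
        hsn.var_ne (hI hy) (hI hz),
        complexMGF_const_add hXmeas hX0 hXadapted hind t₀ (y + z) hn.le] at hcov
      have hs0z : (s0 : ℂ) ^ (y + z) = Complex.exp ((y + z) * t₀) := by
        rw [← hexp_cpow, ht₀, Real.exp_log hs0]
      have hv := hsn.var_ne
      simp only [hF, Nat.add_sub_cancel]
      rw [hcov, hs0z, hhV y hy, hhV z hz, hb]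
      simp only [hρ, hmM, Nat.add_sub_cancel, hedgeRatio, one_add_one_eq_two]
      rw [← pow_two]
      field_simp
  have hFin : ∀ k ∈ Finset.Icc 1 N, ∀ᵐ y ∂μ, Integrable (fun z => F k y z * w z) μ :=
    fun k hk => by
      obtain ⟨n, rfl⟩ : ∃ n, k = n + 1 := ⟨k - 1, by have := (Finset.mem_Icc.1 hk).1; omega⟩
      filter_upwards [hstrip] with y hy
      exact (hs n (Finset.mem_Icc.1 hk).2).integrable_covariance_inner hy
  have hFout : ∀ k ∈ Finset.Icc 1 N,
      Integrable (fun y => (∫ z, F k y z * w z ∂μ) * w y) μ := fun k hk => by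
    obtain ⟨n, rfl⟩ : ∃ n, k = n + 1 := ⟨k - 1, by have := (Finset.mem_Icc.1 hk).1; omega⟩
    exact (hs n (Finset.mem_Icc.1 hk).2).integral_gain_sq.1
  have hJint : ∫ y, (∫ z, J0 y z * w z ∂μ) * w y ∂μ = ∫ y, (∫ z, (∑ k ∈ Finset.Icc 1 N,
      (∏ j ∈ Finset.Icc (k + 1) N, a j) * F k y z) * w z ∂μ) * w y ∂μ := by
    refine integral_congr_ae ?_
    filter_upwards [hconc] with y hy
    congr 1
    refine integral_congr_ae ?_
    filter_upwards [hconc] with z hz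
    rw [hJF y z hy hz]
  rw [hJint, integral_integral_sum_mul _ _ hFin hFout]
  simp_rw [hHV]
  rw [hsum]
  push_cast
  refine Finset.sum_congr rfl fun k hk => ?_
  obtain ⟨n, rfl⟩ : ∃ n, k = n + 1 := ⟨k - 1, by have := (Finset.mem_Icc.1 hk).1; omega⟩
  have hn : n < N := (Finset.mem_Icc.1 hk).2
  rw [hLsq n hn, (hs n hn).integral_gain_sq.2]
  simp only [haA]
  rfl
end

section
/- Completeness of the (possibly inhomogeneous) binomial model: let a, b ∈ ℝ with a ≠ b, and suppose each increment ΔX_k takes the value a with probability p_k ∈ (0,1) and the value b with probability 1 − p_k. Then for every k and every y, z ∈ ℂ, ρ(y,z;k) ρ(1,1;k) = ρ(y,1;k) ρ(z,1;k), hence b(y,z;k) = 0; consequently J_0(y,z) = 0 for every y, z with 2 Re(y), 2 Re(z) ∈ D, and the variance-optimal hedging error vanishes. -/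
open MeasureTheory ProbabilityTheory

/-- A real random variable `D` with `P (D = a) = p` and `P (D = b) = 1 - p`, where `a ≠ b`,
satisfies `E[f D] = p f(a) + (1 - p) f(b)`. -/
theorem integral_comp_of_two_point {Ω : Type*} {m0 : MeasurableSpace Ω} (P : Measure Ω)
    [IsProbabilityMeasure P] {D : Ω → ℝ} (hD : Measurable D) {a b p : ℝ} (hab : a ≠ b)
    (hp0 : 0 ≤ p) (hp1 : p ≤ 1) (ha : P {ω | D ω = a} = ENNReal.ofReal p)
    (hb : P {ω | D ω = b} = ENNReal.ofReal (1 - p)) (f : ℝ → ℂ) :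
    ∫ ω, f (D ω) ∂P = p * f a + (1 - p) * f b := by
  have hA : MeasurableSet {ω | D ω = a} := hD (measurableSet_singleton a)
  have hB : MeasurableSet {ω | D ω = b} := hD (measurableSet_singleton b)
  have hdisj : Disjoint {ω | D ω = a} {ω | D ω = b} :=
    Set.disjoint_left.2 fun ω h1 h2 => hab (h1.symm.trans h2)
  have hfull : P ({ω | D ω = a} ∪ {ω | D ω = b}) = 1 := by
    rw [measure_union hdisj hB, ha, hb, ← ENNReal.ofReal_add hp0 (by linarith)]
    simp
  have hae : ∀ᵐ ω ∂P, ω ∈ {ω | D ω = a} ∪ {ω | D ω = b} :=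
    (mem_ae_iff_prob_eq_one (hA.union hB)).2 hfull
  have hsplit : (fun ω => f (D ω)) =ᵐ[P] fun ω =>
      {ω | D ω = a}.indicator (fun _ => f a) ω + {ω | D ω = b}.indicator (fun _ => f b) ω := by
    filter_upwards [hae] with ω hω
    rcases hω with hω | hω <;> simp only [Set.mem_ofPred_eq] at hω <;>
      simp [Set.indicator, hω, hab, hab.symm]
  rw [integral_congr_ae hsplit, integral_add ((integrable_const _).indicator hA)
    ((integrable_const _).indicator hB), integral_indicator_const _ hA,
    integral_indicator_const _ hB, Measure.real, Measure.real, ha, hb,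
    ENNReal.toReal_ofReal hp0, ENNReal.toReal_ofReal (by linarith)]
  simp

/-- Completeness of the (possibly inhomogeneous) binomial model.  Let
`a, b ∈ ℝ`, `a ≠ b`, and suppose each increment `ΔX_k` takes the value `a` with probability
`p_k ∈ (0,1)` and the value `b` with probability `1 − p_k`.  Then for every `k` and all
`y, z ∈ ℂ`, `ρ(y,z;k) ρ(1,1;k) = ρ(y,1;k) ρ(z,1;k)`, hence `b(y,z;k) = 0`; consequently
`J₀(y,z) = 0` for every `y, z` (here `D = ℂ` since the increments are bounded, so
`2 Re(y), 2 Re(z) ∈ D` always holds) and the variance-optimal hedging error vanishes. -/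
theorem stmt_13 {Ω : Type*} {m0 : MeasurableSpace Ω} (P : Measure Ω) [IsProbabilityMeasure P]
    (N : ℕ) (hN : 1 ≤ N)
    (X : ℕ → Ω → ℝ) (hXmeas : ∀ n, Measurable (X n)) (hX0 : ∀ ω, X 0 ω = 0)
    (hindep : iIndepFun
      (fun (k : Fin N) (ω : Ω) => X (k.val + 1) ω - X k.val ω) P)
    (s0 : ℝ) (hs0 : 0 < s0)
    (S : ℕ → Ω → ℝ) (hS : ∀ n ω, S n ω = s0 * Real.exp (X n ω))
    -- the binomial increments
    (a b : ℝ) (hab : a ≠ b) (p : ℕ → ℝ)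
    (hp : ∀ k, 1 ≤ k → k ≤ N → 0 < p k ∧ p k < 1)
    (hdista : ∀ k, 1 ≤ k → k ≤ N →
      P {ω | X k ω - X (k - 1) ω = a} = ENNReal.ofReal (p k))
    (hdistb : ∀ k, 1 ≤ k → k ≤ N →
      P {ω | X k ω - X (k - 1) ω = b} = ENNReal.ofReal (1 - p k))
    -- the cumulant generating function and the error-formula ingredients
    (m : ℂ → ℕ → ℂ)
    (hm : ∀ v n, m v n = ∫ ω, Complex.exp (v * (X n ω - X (n - 1) ω)) ∂P)
    (g : ℂ → ℕ → ℂ)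
    (hg : ∀ v n, g v n = (m (v + 1) n - m 1 n * m v n) / (m 2 n - (m 1 n) ^ 2))
    (h : ℂ → ℕ → ℂ)
    (hh : ∀ v n, h v n = ∏ i ∈ Finset.Icc (n + 1) N, (m v i - g v i * (m 1 i - 1)))
    (afun : ℕ → ℂ)
    (ha : ∀ j, afun j = (m 2 j - (m 1 j) ^ 2) / (m 2 j - 2 * m 1 j + 1))
    (ρ : ℂ → ℂ → ℕ → ℂ)
    (hρ : ∀ y z k, ρ y z k = m (y + z) k - m y k * m z k)
    (bfun : ℂ → ℂ → ℕ → ℂ)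
    (hb : ∀ y z k, bfun y z k = (ρ y z k * ρ 1 1 k - ρ y 1 k * ρ z 1 k) / ρ 1 1 k)
    (J0 : ℂ → ℂ → ℂ)
    (hJ0 : ∀ y z : ℂ,
      J0 y z = (s0 : ℂ) ^ (y + z) *
        ∑ k ∈ Finset.Icc 1 N, bfun y z k * h z k * h y k *
          (∏ l ∈ Finset.Icc 2 k, m (y + z) (l - 1)) *
          ∏ j ∈ Finset.Icc (k + 1) N, afun j) :
    (∀ k, 1 ≤ k → k ≤ N → ∀ y z : ℂ,
        ρ y z k * ρ 1 1 k = ρ y 1 k * ρ z 1 k ∧ bfun y z k = 0)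
    ∧ (∀ y z : ℂ, J0 y z = 0) := by
  have hmgf : ∀ k, 1 ≤ k → k ≤ N → ∀ v : ℂ,
      m v k = p k * Complex.exp (v * a) + (1 - p k) * Complex.exp (v * b) := by
    intro k hk1 hkN v
    have hint := integral_comp_of_two_point P ((hXmeas k).sub (hXmeas (k - 1))) hab
      (hp k hk1 hkN).1.le (hp k hk1 hkN).2.le (hdista k hk1 hkN) (hdistb k hk1 hkN)
      (fun x => Complex.exp (v * x))
    rw [hm, ← hint]
    simp
  have hcov : ∀ k, 1 ≤ k → k ≤ N → ∀ y z : ℂ, ρ y z k = p k * (1 - p k) *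
      (Complex.exp (y * a) - Complex.exp (y * b)) *
      (Complex.exp (z * a) - Complex.exp (z * b)) := by
    intro k hk1 hkN y z
    simp only [hρ, hmgf k hk1 hkN, add_mul, Complex.exp_add]
    ring
  have hdegenerate : ∀ k, 1 ≤ k → k ≤ N → ∀ y z : ℂ,
      ρ y z k * ρ 1 1 k = ρ y 1 k * ρ z 1 k := by
    intro k hk1 hkN y z
    simp only [hcov k hk1 hkN]
    ring
  have hbzero : ∀ k, 1 ≤ k → k ≤ N → ∀ y z : ℂ, bfun y z k = 0 := by
    intro k hk1 hkN y z
    rw [hb, hdegenerate k hk1 hkN, sub_self, zero_div]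
  refine ⟨fun k hk1 hkN y z => ⟨hdegenerate k hk1 hkN y z, hbzero k hk1 hkN y z⟩, fun y z => ?_⟩
  rw [hJ0, Finset.sum_eq_zero, mul_zero]
  intro k hk
  obtain ⟨hk1, hkN⟩ := Finset.mem_Icc.1 hk
  simp [hbzero k hk1 hkN]
end
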